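/- arXiv:1707.05832 — 2 statements merged into one kernel-verified Lean document; each statement's English description precedes it below -/
import Mathlib

section
/- Complete summation formula for skew Schur functions: for 2h alphabets X^0,...,X^{h-1} and Y^0,...,Y^{h-1}, with X = X^0+...+X^{h-1} and Y = Y^0+...+Y^{h-1} their unions, one has Σ_{λ^0,...,λ^h} Σ_{μ^0,...,μ^{h-1}} z^{|λ^h|} ∏_{i=0}^{h-1} s_{λ^i/μ^i}(X^i) s_{λ^{i+1}/μ^i}(Y^i) = ∏_{0≤i<j≤h-1} Ψ(Y^i, X^j) · Φ(X) · ∏_{k≥1} Φ(z^k(X+Y))/(1−z^k), as an identity of formal power series, where the sums range over all integer partitions and z^k X denotes the alphabet X with every variable multiplied by z^k. -/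
open scoped BigOperators

/-- An integer partition: a weakly decreasing, finitely supported sequence of
nonnegative integers. -/
structure Ptn where
  toFun : ℕ →₀ ℕ
  antitone' : ∀ ⦃i j : ℕ⦄, i ≤ j → toFun j ≤ toFun i

namespace Ptn
/-- the `i`-th part (0-indexed) -/
def part (lam : Ptn) (i : ℕ) : ℕ := lam.toFun i
/-- the size `|λ|` -/
def size (lam : Ptn) : ℕ := lam.toFun.sum fun _ k => k
end Ptn

/-- `HStrip μ λ` means `μ ≺ λ`, i.e. `λ/μ` is a horizontal strip:
`λ_i ≥ μ_i ≥ λ_{i+1}` for all `i`. -/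
def HStrip (mu lam : Ptn) : Prop :=
  ∀ i : ℕ, mu.part i ≤ lam.part i ∧ lam.part (i + 1) ≤ mu.part i
/-- Chains of partitions `μ = c 0 ≺ c 1 ≺ ⋯` stabilizing at `λ`; these encode
semistandard Young tableaux of shape `λ/μ` with entries in `{0, 1, 2, …}`. -/
def IsSchurChain (mu lam : Ptn) (c : ℕ → Ptn) : Prop :=
  c 0 = mu ∧ (∀ i, HStrip (c i) (c (i + 1))) ∧ ∃ N, ∀ i, N ≤ i → c i = lam

/-- the monomial attached to a chain: the variable `X i` records the cells added
at step `i` of the chain -/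
noncomputable def chainWeight {R : Type*} [CommRing R] (X : ℕ → R) (c : ℕ → Ptn) : R :=
  ∏ᶠ i : ℕ, X i ^ ((c (i + 1)).size - (c i).size)

/-- the skew Schur function `s_{λ/μ}(X)` (which is `0` if `μ ⊄ λ`) -/
noncomputable def skewSchur {R : Type*} [CommRing R] [TopologicalSpace R]
    (X : ℕ → R) (lam mu : Ptn) : R :=
  ∑' c : {c : ℕ → Ptn // IsSchurChain mu lam c}, chainWeight X c.1

/-- `Ψ(X,Y) = ∏_{i,j} (1 - x_i y_j)⁻¹` -/
noncomputable def Psi {R : Type*} [CommRing R] [TopologicalSpace R] [Inv R] (X Y : ℕ → R) : R :=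
  ∏' p : ℕ × ℕ, (1 - X p.1 * Y p.2)⁻¹

/-- `Φ(X) = ∏_i (1 - x_i)⁻¹ ∏_{i<j} (1 - x_i x_j)⁻¹` -/
noncomputable def Phi {R : Type*} [CommRing R] [TopologicalSpace R] [Inv R] (X : ℕ → R) : R :=
  (∏' i : ℕ, (1 - X i)⁻¹) * ∏' p : {q : ℕ × ℕ // q.1 < q.2}, (1 - X p.1.1 * X p.1.2)⁻¹
/-- the coefficientwise (product) topology on multivariate formal power series -/
instance (σ : Type*) : TopologicalSpace (MvPowerSeries σ ℚ) :=
  inferInstanceAs (TopologicalSpace ((σ →₀ ℕ) → ℚ))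

/-- the ambient ring: formal power series in the independent variables
`x^{(i)}_n`, `y^{(i)}_n` (`i, n ∈ ℕ`) and `z` -/
abbrev R1 : Type := MvPowerSeries ((Bool × ℕ × ℕ) ⊕ Unit) ℚ

/-- the alphabet `X^i = {x^{(i)}_0, x^{(i)}_1, …}` -/
noncomputable def Xa (i n : ℕ) : R1 := MvPowerSeries.X (Sum.inl (false, i, n))

/-- the alphabet `Y^i = {y^{(i)}_0, y^{(i)}_1, …}` -/
noncomputable def Ya (i n : ℕ) : R1 := MvPowerSeries.X (Sum.inl (true, i, n))

/-- the extra formal variable `z` -/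
noncomputable def z : R1 := MvPowerSeries.X (Sum.inr ())

/-- the union (disjoint sum) of the alphabets `A 0, …, A (h-1)` -/
noncomputable def unionA (h : ℕ) (A : ℕ → ℕ → R1) : ℕ → R1 :=
  fun n => if h = 0 then 0 else A (n % h) (n / h)

/-- the union `X + Y` of the two full alphabets `X = X^0 + ⋯ + X^{h-1}` and
`Y = Y^0 + ⋯ + Y^{h-1}` -/
noncomputable def unionXY (h : ℕ) : ℕ → R1 :=
  fun n => if n % 2 = 0 then unionA h Xa (n / 2) else unionA h Ya (n / 2)

namespace CompleteSummation

/-! ### Formal sums over `ℝ≥0∞`, where every family is summable -/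

section FormalSum

variable {σ : Type*}

/-- Power series with coefficients in `ℝ≥0∞`. -/
abbrev EPS (σ : Type*) : Type _ := MvPowerSeries σ ENNReal

/-- The coefficientwise sum of an arbitrary family. -/
noncomputable def ssum {ι : Type*} (f : ι → EPS σ) : EPS σ :=
  fun d => ∑' i, MvPowerSeries.coeff d (f i)

theorem coeff_ssum {ι : Type*} (f : ι → EPS σ) (d : σ →₀ ℕ) :
    MvPowerSeries.coeff d (ssum f) = ∑' i, MvPowerSeries.coeff d (f i) := rfl

theorem ssum_comm {ι κ : Type*} (f : ι → κ → EPS σ) :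
    ssum (fun i => ssum fun j => f i j) = ssum fun j => ssum fun i => f i j := by
  ext d
  simp only [coeff_ssum]
  exact ENNReal.tsum_comm

theorem ssum_prod {ι κ : Type*} (f : ι × κ → EPS σ) :
    ssum f = ssum fun i => ssum fun j => f (i, j) := by
  ext d
  simp only [coeff_ssum]
  exact ENNReal.tsum_prod (f := fun i j => MvPowerSeries.coeff d (f (i, j)))

theorem ssum_equiv {ι κ : Type*} (e : ι ≃ κ) (f : κ → EPS σ) :
    ssum (fun i => f (e i)) = ssum f := by
  ext d
  simp only [coeff_ssum]
  exact e.tsum_eq (fun j => MvPowerSeries.coeff d (f j))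

theorem mul_ssum {ι : Type*} (c : EPS σ) (f : ι → EPS σ) :
    c * ssum f = ssum fun i => c * f i := by
  classical
  ext d
  simp only [coeff_ssum, MvPowerSeries.coeff_mul, ← ENNReal.tsum_mul_left]
  rw [Summable.tsum_finsetSum fun _ _ => ENNReal.summable]

theorem ssum_mul {ι : Type*} (c : EPS σ) (f : ι → EPS σ) :
    ssum f * c = ssum fun i => f i * c := by
  simp only [mul_comm _ c, mul_ssum]

theorem ssum_eq_single {ι : Type*} (a : ι) (f : ι → EPS σ) (hf : ∀ i, i ≠ a → f i = 0) :
    ssum f = f a := by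
  ext d
  rw [coeff_ssum]
  exact tsum_eq_single a fun i hi => by simp [hf i hi]

theorem ssum_subtype {ι : Type*} (p : ι → Prop) (f : ι → EPS σ) (hf : ∀ i, ¬ p i → f i = 0) :
    ssum (fun i : {i // p i} => f i) = ssum f := by
  ext d
  simp only [coeff_ssum]
  refine tsum_subtype_eq_of_support_subset (f := fun i => MvPowerSeries.coeff d (f i))
    (s := {i | p i}) fun i hi => ?_
  by_contra h
  exact hi (by simp [hf i h])

theorem ssum_zero {ι : Type*} : ssum (fun _ : ι => (0 : EPS σ)) = 0 := by
  ext d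
  simp [coeff_ssum]

theorem ssum_eq_sum {ι : Type*} (s : Finset ι) (f : ι → EPS σ) (hf : ∀ i ∉ s, f i = 0) :
    ssum f = ∑ i ∈ s, f i := by
  ext d
  rw [coeff_ssum, map_sum]
  exact tsum_eq_sum fun i hi => by simp [hf i hi]

theorem ssum_nat {f : ℕ → EPS σ} : ssum f = f 0 + ssum fun k => f (k + 1) := by
  ext d
  rw [map_add, coeff_ssum, coeff_ssum]
  exact tsum_eq_zero_add' ENNReal.summable

/-- The geometric series `∑ m ^ k`. -/
noncomputable def geo (m : EPS σ) : EPS σ := ssum fun k : ℕ => m ^ k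

theorem geo_eq (m : EPS σ) : geo m = 1 + m * geo m := by
  conv_lhs => rw [geo, ssum_nat]
  simp only [geo, mul_ssum, pow_zero, pow_succ']

end FormalSum

/-! ### Equality of power series up to a given exponent -/

section Congruence

variable {σ A : Type*} [CommSemiring A]

/-- `f` and `g` have the same coefficients at all exponents `e ≤ d`. -/
def Cong (d : σ →₀ ℕ) (f g : MvPowerSeries σ A) : Prop :=
  ∀ e ≤ d, MvPowerSeries.coeff e f = MvPowerSeries.coeff e g

variable {d : σ →₀ ℕ} {f g f' g' k : MvPowerSeries σ A}

theorem Cong.refl (f : MvPowerSeries σ A) : Cong d f f := fun _ _ => rfl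

theorem Cong.trans (h : Cong d f g) (h' : Cong d g k) : Cong d f k :=
  fun e he => (h e he).trans (h' e he)

theorem Cong.coeff_eq (h : Cong d f g) : MvPowerSeries.coeff d f = MvPowerSeries.coeff d g :=
  h d le_rfl

theorem Cong.mono {d' : σ →₀ ℕ} (h : Cong d f g) (hd : d' ≤ d) : Cong d' f g :=
  fun e he => h e (he.trans hd)

theorem Cong.add (h : Cong d f g) (h' : Cong d f' g') : Cong d (f + f') (g + g') :=
  fun e he => by rw [map_add, map_add, h e he, h' e he]

theorem Cong.mul (h : Cong d f g) (h' : Cong d f' g') : Cong d (f * f') (g * g') := by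
  classical
  intro e he
  rw [MvPowerSeries.coeff_mul, MvPowerSeries.coeff_mul]
  refine Finset.sum_congr rfl fun p hp => ?_
  have hp' := Finset.HasAntidiagonal.mem_antidiagonal.1 hp
  rw [h p.1 (le_trans (by rw [← hp']; exact le_self_add) he),
    h' p.2 (le_trans (by rw [← hp']; exact le_add_self) he)]

theorem Cong.prod {ι : Type*} {s : Finset ι} {u v : ι → MvPowerSeries σ A}
    (h : ∀ i ∈ s, Cong d (u i) (v i)) : Cong d (∏ i ∈ s, u i) (∏ i ∈ s, v i) := by
  classical
  induction s using Finset.induction_on with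
  | empty => exact Cong.refl _
  | insert a s ha ih =>
    rw [Finset.prod_insert ha, Finset.prod_insert ha]
    exact (h a (by simp)).mul (ih fun i hi => h i (by simp [hi]))

theorem Cong.zero_mul (h : Cong d f 0) (g : MvPowerSeries σ A) : Cong d (f * g) 0 := by
  simpa using h.mul (Cong.refl g)

theorem Cong.mul_zero (g : MvPowerSeries σ A) (h : Cong d f 0) : Cong d (g * f) 0 := by
  simpa using (Cong.refl g).mul h

theorem Cong.pow_zero {n : ℕ} (h : Cong d f 0) (hn : n ≠ 0) : Cong d (f ^ n) 0 := by
  obtain ⟨n, rfl⟩ := Nat.exists_eq_succ_of_ne_zero hn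
  rw [pow_succ]
  exact Cong.mul_zero _ h

theorem Cong.prod_zero {ι : Type*} {s : Finset ι} {u : ι → MvPowerSeries σ A} {i : ι}
    (hi : i ∈ s) (h : Cong d (u i) 0) : Cong d (∏ i ∈ s, u i) 0 := by
  classical
  rw [← Finset.mul_prod_erase s u hi]
  exact h.zero_mul _

theorem Cong.ssum {ι : Type*} {u v : ι → EPS σ} (h : ∀ i, Cong d (u i) (v i)) :
    Cong d (ssum u) (ssum v) := fun e he => by
  rw [coeff_ssum, coeff_ssum]
  exact tsum_congr fun i => h i e he

theorem cong_X_zero {s : σ} (h : d s = 0) : Cong d (MvPowerSeries.X s : MvPowerSeries σ A) 0 := by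
  classical
  intro e he
  rw [MvPowerSeries.coeff_X, if_neg, map_zero]
  rintro rfl
  have := he s
  simp [h] at this

theorem cong_X_pow_zero {s : σ} {n : ℕ} (h : d s < n) :
    Cong d ((MvPowerSeries.X s : MvPowerSeries σ A) ^ n) 0 := by
  classical
  intro e he
  rw [MvPowerSeries.coeff_X_pow, if_neg, map_zero]
  rintro rfl
  have := he s
  simp at this
  omega

end Congruence

/-! ### Partitions and horizontal strips -/

section Partition

theorem part_anti (lam : Ptn) {i j : ℕ} (h : i ≤ j) : lam.part j ≤ lam.part i := lam.antitone' h

theorem ptn_ext {lam mu : Ptn} (h : ∀ i, lam.part i = mu.part i) : lam = mu := by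
  cases lam; cases mu
  congr 1
  exact Finsupp.ext h

theorem exists_part_eq_zero (lam : Ptn) : ∃ M, ∀ i, M ≤ i → lam.part i = 0 := by
  refine ⟨lam.toFun.support.sup id + 1, fun i hi => ?_⟩
  by_contra h
  have := Finset.le_sup (f := id) (Finsupp.mem_support_iff.2 h)
  simp only [id] at this
  omega

/-- The partition with prescribed parts. -/
noncomputable def ofParts (f : ℕ → ℕ) (hf : ∀ i, f (i + 1) ≤ f i)
    (h0 : ∃ M, ∀ i, M ≤ i → f i = 0) : Ptn where
  toFun := Finsupp.ofSupportFinite f <| by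
    obtain ⟨M, hM⟩ := h0
    refine (Set.finite_lt_nat M).subset fun i hi => ?_
    by_contra h
    exact hi (hM i (not_lt.1 h))
  antitone' := fun _ _ h => antitone_nat_of_succ_le hf h

@[simp] theorem part_ofParts (f : ℕ → ℕ) (hf : ∀ i, f (i + 1) ≤ f i)
    (h0 : ∃ M, ∀ i, M ≤ i → f i = 0) (i : ℕ) : (ofParts f hf h0).part i = f i := rfl

theorem size_eq_sum (lam : Ptn) {M : ℕ} (hM : ∀ i, M ≤ i → lam.part i = 0) :
    lam.size = ∑ i ∈ Finset.range M, lam.part i := by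
  refine Finsupp.sum_of_support_subset _ (fun i hi => ?_) _ fun _ _ => rfl
  by_contra h
  exact (Finsupp.mem_support_iff.1 hi) (hM i (by simpa using h))

theorem size_le_of_part_le {mu lam : Ptn} (h : ∀ i, mu.part i ≤ lam.part i) :
    mu.size ≤ lam.size := by
  obtain ⟨M, hM⟩ := exists_part_eq_zero lam
  rw [size_eq_sum lam hM, size_eq_sum mu fun i hi => Nat.le_zero.1 ((h i).trans (hM i hi).le)]
  exact Finset.sum_le_sum fun i _ => h i

theorem hstrip_size_le {mu lam : Ptn} (h : HStrip mu lam) : mu.size ≤ lam.size :=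
  size_le_of_part_le fun i => (h i).1

theorem hstrip_refl (lam : Ptn) : HStrip lam lam :=
  fun _ => ⟨le_rfl, part_anti lam (Nat.le_succ _)⟩

theorem hstrip_eq_of_size {mu lam : Ptn} (h : HStrip mu lam) (hs : lam.size ≤ mu.size) :
    mu = lam := by
  obtain ⟨M, hM⟩ := exists_part_eq_zero lam
  rw [size_eq_sum lam hM,
    size_eq_sum mu fun i hi => Nat.le_zero.1 ((h i).1.trans (hM i hi).le)] at hs
  refine ptn_ext fun i => ?_
  by_cases hi : i < M
  · exact (Finset.sum_eq_sum_iff_of_le fun i _ => (h i).1).1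
      (le_antisymm (Finset.sum_le_sum fun i _ => (h i).1) hs) i (Finset.mem_range.2 hi)
  · have := (h i).1
    have := hM i (not_lt.1 hi)
    omega

theorem finite_hstrip_le (lam : Ptn) : {mu : Ptn | HStrip mu lam}.Finite := by
  obtain ⟨M, hM⟩ := exists_part_eq_zero lam
  refine Set.Finite.of_finite_image (f := fun mu : Ptn => fun i : Fin M => mu.part i) ?_ ?_
  · refine (Set.Finite.pi fun i : Fin M => Set.finite_le_nat (lam.part i)).subset ?_
    rintro _ ⟨mu, hmu, rfl⟩ i -
    exact (hmu i).1
  · intro mu hmu nu hnu h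
    refine ptn_ext fun i => ?_
    by_cases hi : i < M
    · exact congrFun h ⟨i, hi⟩
    · have h1 := (hmu i).1
      have h2 := (hnu i).1
      have := hM i (not_lt.1 hi)
      omega

/-- The local rule: partitions above both `μ` and `ν` correspond to partitions below both of
them together with a natural number. -/
noncomputable def localRule (mu nu : Ptn) :
    {lam : Ptn // HStrip mu lam ∧ HStrip nu lam} ≃
      ℕ × {kap : Ptn // HStrip kap mu ∧ HStrip kap nu} where
  toFun lam := (lam.1.part 0 - max (mu.part 0) (nu.part 0),
    ⟨ofParts (fun i => min (mu.part i) (nu.part i) + max (mu.part (i + 1)) (nu.part (i + 1))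
        - lam.1.part (i + 1))
      (fun i => by
        have h1 := lam.2.1 (i + 1)
        have h2 := lam.2.2 (i + 1)
        have h3 := lam.2.1 (i + 1 + 1)
        have h4 := lam.2.2 (i + 1 + 1)
        have h5 := lam.2.1 i
        have h6 := lam.2.2 i
        omega)
      (by
        obtain ⟨M, hM⟩ := exists_part_eq_zero mu
        refine ⟨M, fun i hi => ?_⟩
        have h1 := lam.2.1 (i + 1)
        have h2 := lam.2.2 (i + 1)
        have h3 := hM i hi
        omega),
      fun i => by
        have h1 := lam.2.1 (i + 1)
        have h2 := lam.2.2 (i + 1)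
        have h5 := lam.2.1 i
        have h6 := lam.2.2 i
        simp only [part_ofParts]
        omega,
      fun i => by
        have h1 := lam.2.1 (i + 1)
        have h2 := lam.2.2 (i + 1)
        have h5 := lam.2.1 i
        have h6 := lam.2.2 i
        simp only [part_ofParts]
        omega⟩)
  invFun p := ⟨ofParts (fun i => max (mu.part i) (nu.part i) +
        (if i = 0 then p.1 else min (mu.part (i - 1)) (nu.part (i - 1)) - p.2.1.part (i - 1)))
      (fun i => by
        have h1 := part_anti mu (Nat.le_succ i)
        have h2 := part_anti nu (Nat.le_succ i)
        have h3 := p.2.2.1 i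
        have h4 := p.2.2.2 i
        simp only [Nat.succ_eq_add_one] at h1 h2
        simp only [Nat.succ_ne_zero, if_false, Nat.add_sub_cancel]
        omega)
      (by
        obtain ⟨M, hM⟩ := exists_part_eq_zero mu
        obtain ⟨M', hM'⟩ := exists_part_eq_zero nu
        refine ⟨M + M' + 1, fun i hi => ?_⟩
        have h1 := hM i (by omega)
        have h2 := hM' i (by omega)
        have h3 := hM (i - 1) (by omega)
        rw [if_neg (by omega)]
        omega),
      fun i => by
        have h3 := p.2.2.1 i
        have h4 := p.2.2.2 i
        simp only [part_ofParts, Nat.succ_ne_zero, if_false, Nat.add_sub_cancel]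
        omega,
      fun i => by
        have h3 := p.2.2.1 i
        have h4 := p.2.2.2 i
        simp only [part_ofParts, Nat.succ_ne_zero, if_false, Nat.add_sub_cancel]
        omega⟩
  left_inv lam := by
    refine Subtype.ext (ptn_ext fun i => ?_)
    have h1 := lam.2.1 i
    have h2 := lam.2.2 i
    rcases i with _ | i
    · simp only [part_ofParts, if_true]
      omega
    · have h3 := lam.2.1 i
      have h4 := lam.2.2 i
      simp only [part_ofParts, Nat.succ_ne_zero, if_false, Nat.add_sub_cancel]
      omega
  right_inv p := by
    refine Prod.ext ?_ (Subtype.ext (ptn_ext fun i => ?_))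
    · simp
    · have h3 := p.2.2.1 i
      have h4 := p.2.2.2 i
      simp only [part_ofParts, Nat.succ_ne_zero, if_false, Nat.add_sub_cancel]
      omega

theorem localRule_size (mu nu : Ptn) (lam : {lam : Ptn // HStrip mu lam ∧ HStrip nu lam}) :
    lam.1.size + (localRule mu nu lam).2.1.size
      = mu.size + nu.size + (localRule mu nu lam).1 := by
  obtain ⟨M, hM⟩ := exists_part_eq_zero lam.1
  have hmu : ∀ i, M ≤ i → mu.part i = 0 := fun i hi => by
    have := (lam.2.1 i).1
    have := hM i hi
    omega
  have hnu : ∀ i, M ≤ i → nu.part i = 0 := fun i hi => by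
    have := (lam.2.2 i).1
    have := hM i hi
    omega
  set kap := (localRule mu nu lam).2 with hkap
  have hk : ∀ i, M ≤ i → kap.1.part i = 0 := fun i hi => by
    have := (kap.2.1 i).1
    have := hmu i hi
    omega
  rw [size_eq_sum lam.1 (M := M + 1) fun i hi => hM i (by omega), size_eq_sum kap.1 hk,
    size_eq_sum mu (M := M + 1) fun i hi => hmu i (by omega),
    size_eq_sum nu (M := M + 1) fun i hi => hnu i (by omega), ← Finset.sum_add_distrib,
    Finset.sum_range_succ' (fun i => lam.1.part i), add_right_comm, ← Finset.sum_add_distrib,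
    Finset.sum_congr rfl (g := fun i => min (mu.part i) (nu.part i) +
      max (mu.part (i + 1)) (nu.part (i + 1))), Finset.sum_add_distrib]
  · have h1 := Finset.sum_range_succ' (fun i => max (mu.part i) (nu.part i)) M
    have h2 := Finset.sum_range_succ (fun i => max (mu.part i) (nu.part i)) M
    have h3 : ∑ i ∈ Finset.range (M + 1), (mu.part i + nu.part i)
        = ∑ i ∈ Finset.range M, min (mu.part i) (nu.part i)
          + ∑ i ∈ Finset.range M, max (mu.part i) (nu.part i) := by
      rw [Finset.sum_range_succ, hmu M le_rfl, hnu M le_rfl, ← Finset.sum_add_distrib]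
      simp only [add_zero]
      exact Finset.sum_congr rfl fun i _ => (min_add_max _ _).symm
    have h4 : (localRule mu nu lam).1 = lam.1.part 0 - max (mu.part 0) (nu.part 0) := rfl
    have h5 := (lam.2.1 0).1
    have h6 := (lam.2.2 0).1
    have h7 := hmu M le_rfl
    have h8 := hnu M le_rfl
    simp only [h7, h8, max_self] at h2
    omega
  · intro i _
    have h1 := lam.2.1 (i + 1)
    have h2 := lam.2.2 (i + 1)
    have h5 := lam.2.1 i
    have h6 := lam.2.2 i
    have h7 : kap.1.part i = min (mu.part i) (nu.part i) +
      max (mu.part (i + 1)) (nu.part (i + 1)) - lam.1.part (i + 1) := rfl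
    omega

/-- Removing the columns of length `K + 1` from a partition with at most `K + 1` parts. -/
noncomputable def removeColumns (K : ℕ) :
    {lam : Ptn // lam.part (K + 1) = 0} ≃ ℕ × {lam : Ptn // lam.part K = 0} where
  toFun lam := (lam.1.part K, ⟨ofParts (fun i => lam.1.part i - lam.1.part K)
      (fun i => Nat.sub_le_sub_right (part_anti _ (Nat.le_succ i)) _)
      ⟨K, fun _ hi => Nat.sub_eq_zero_of_le (part_anti _ hi)⟩, by simp⟩)
  invFun p := ⟨ofParts (fun i => p.2.1.part i + if i ≤ K then p.1 else 0)
      (fun i => by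
        have := part_anti p.2.1 (Nat.le_succ i)
        simp only [Nat.succ_eq_add_one] at this
        split_ifs <;> omega)
      ⟨K + 1, fun i hi => by
        have := part_anti p.2.1 (show K ≤ i by omega)
        have := p.2.2
        rw [if_neg (by omega)]
        omega⟩, by
        have h1 : p.2.1.part (K + 1) ≤ p.2.1.part K := part_anti p.2.1 (Nat.le_succ K)
        have h2 : p.2.1.part K = 0 := p.2.2
        simp only [part_ofParts]
        rw [if_neg (by omega)]
        omega⟩
  left_inv lam := by
    refine Subtype.ext (ptn_ext fun i => ?_)
    simp only [part_ofParts]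
    split_ifs with h
    · have := part_anti lam.1 h
      omega
    · have := part_anti lam.1 (show K + 1 ≤ i by omega)
      have := lam.2
      omega
  right_inv p := by
    have h := p.2.2
    refine Prod.ext ?_ (Subtype.ext (ptn_ext fun i => ?_))
    · simp [h]
    · simp only [part_ofParts, le_refl, if_true]
      split_ifs with hi
      · omega
      · have := part_anti p.2.1 (show K ≤ i by omega)
        omega

theorem removeColumns_size (K : ℕ) (lam : {lam : Ptn // lam.part (K + 1) = 0}) :
    lam.1.size = (K + 1) * (removeColumns K lam).1 + (removeColumns K lam).2.1.size := by
  have h0 : ∀ i, K + 1 ≤ i → lam.1.part i = 0 := fun i hi =>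
    Nat.le_zero.1 ((part_anti _ hi).trans lam.2.le)
  have h1 : ∀ i, K + 1 ≤ i → (removeColumns K lam).2.1.part i = 0 := fun i hi =>
    Nat.le_zero.1 ((part_anti _ (show K ≤ i by omega)).trans (removeColumns K lam).2.2.le)
  rw [size_eq_sum _ h0, size_eq_sum _ h1]
  have h2 : (K + 1) * (removeColumns K lam).1
      = ∑ i ∈ Finset.range (K + 1), (removeColumns K lam).1 := by simp
  rw [h2, ← Finset.sum_add_distrib]
  refine Finset.sum_congr rfl fun i hi => ?_
  have h3 : (removeColumns K lam).1 = lam.1.part K := rfl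
  have h4 : (removeColumns K lam).2.1.part i = lam.1.part i - lam.1.part K := rfl
  have := part_anti lam.1 (Nat.lt_succ_iff.1 (Finset.mem_range.1 hi))
  omega

end Partition

/-! ### Adding and removing horizontal strips -/

section Operators

variable {σ : Type*}

open scoped Classical in
/-- The one-variable skew Schur function `s_{λ/μ}(x)`. -/
noncomputable def strip (x : EPS σ) (mu lam : Ptn) : EPS σ :=
  if HStrip mu lam then x ^ (lam.size - mu.size) else 0

/-- Add a horizontal strip weighted by `x`. -/
noncomputable def up (x : EPS σ) (f : Ptn → EPS σ) (lam : Ptn) : EPS σ :=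
  ssum fun mu => strip x mu lam * f mu

/-- Remove a horizontal strip weighted by `x`. -/
noncomputable def down (x : EPS σ) (f : Ptn → EPS σ) (mu : Ptn) : EPS σ :=
  ssum fun lam => strip x mu lam * f lam

theorem up_smul (x c : EPS σ) (f : Ptn → EPS σ) :
    up x (fun lam => c * f lam) = fun lam => c * up x f lam := by
  funext lam
  simp only [up, mul_ssum, mul_left_comm c]

theorem down_smul (x c : EPS σ) (f : Ptn → EPS σ) :
    down x (fun lam => c * f lam) = fun lam => c * down x f lam := by
  funext lam
  simp only [down, mul_ssum, mul_left_comm c]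

theorem strip_cauchy (x y : EPS σ) (mu nu : Ptn) :
    ssum (fun lam => strip x mu lam * strip y nu lam)
      = geo (x * y) * ssum fun kap => strip y kap mu * strip x kap nu := by
  rw [← ssum_subtype (fun lam => HStrip mu lam ∧ HStrip nu lam), geo, ssum_mul,
    ← ssum_subtype (fun kap => HStrip kap mu ∧ HStrip kap nu)]
  · simp only [mul_ssum]
    rw [← ssum_prod (fun p : ℕ × {kap : Ptn // HStrip kap mu ∧ HStrip kap nu} =>
      (x * y) ^ p.1 * (strip y p.2.1 mu * strip x p.2.1 nu)), ← ssum_equiv (localRule mu nu)]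
    congr 1
    funext lam
    have hs := localRule_size mu nu lam
    have h1 := hstrip_size_le lam.2.1
    have h2 := hstrip_size_le lam.2.2
    have h3 := hstrip_size_le (localRule mu nu lam).2.2.1
    have h4 := hstrip_size_le (localRule mu nu lam).2.2.2
    rw [strip, strip, strip, strip, if_pos lam.2.1, if_pos lam.2.2,
      if_pos (localRule mu nu lam).2.2.1, if_pos (localRule mu nu lam).2.2.2,
      show lam.1.size - mu.size
        = (localRule mu nu lam).1 + (nu.size - (localRule mu nu lam).2.1.size) by omega,
      show lam.1.size - nu.size
        = (localRule mu nu lam).1 + (mu.size - (localRule mu nu lam).2.1.size) by omega]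
    ring
  · intro kap h
    rcases not_and_or.1 h with h | h <;> simp [strip, h]
  · intro lam h
    rcases not_and_or.1 h with h | h <;> simp [strip, h]

theorem strip_one_mul (x : EPS σ) (mu lam : Ptn) :
    strip x mu lam * strip 1 mu lam = strip x mu lam := by
  unfold strip
  split_ifs <;> simp

theorem strip_sum (x : EPS σ) (mu : Ptn) :
    ssum (fun lam => strip x mu lam) = geo x * ssum fun kap => strip x kap mu := by
  have h := strip_cauchy x 1 mu mu
  simp only [strip_one_mul, mul_comm (strip 1 _ _), mul_one] at h
  exact h

theorem down_up (x y : EPS σ) (f : Ptn → EPS σ) :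
    down x (up y f) = fun mu => geo (x * y) * up y (down x f) mu := by
  funext mu
  simp only [down, up, mul_ssum]
  rw [ssum_comm]
  have h : ∀ nu, (ssum fun lam => strip x mu lam * (strip y nu lam * f nu))
      = ssum fun kap => geo (x * y) * (strip y kap mu * (strip x kap nu * f nu)) := fun nu => by
    simp only [← mul_assoc, ← ssum_mul]
    rw [strip_cauchy, mul_ssum]
    simp only [mul_assoc]
  simp only [h]
  rw [ssum_comm]

theorem down_one (x : EPS σ) : down x (fun _ => 1) = fun mu => geo x * up x (fun _ => 1) mu := by
  funext mu
  simp only [down, up, mul_one, strip_sum]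

theorem ssum_up (x : EPS σ) (f : Ptn → EPS σ) : ssum (up x f) = geo x * ssum (down x f) := by
  change ssum (fun lam => ssum fun mu => strip x mu lam * f mu)
    = geo x * ssum fun mu => ssum fun lam => strip x mu lam * f lam
  rw [ssum_comm, ssum_comm (fun mu lam => strip x mu lam * f lam), mul_ssum]
  simp only [← ssum_mul, strip_sum, mul_assoc]

/-- Apply `up` successively for the letters of a list, the head first. -/
noncomputable def ups : List (EPS σ) → (Ptn → EPS σ) → Ptn → EPS σ
  | [], f => f
  | x :: l, f => ups l (up x f)

/-- Apply `down` successively for the letters of a list, the head last. -/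
noncomputable def downs : List (EPS σ) → (Ptn → EPS σ) → Ptn → EPS σ
  | [], f => f
  | x :: l, f => down x (downs l f)

theorem ups_append (l l' : List (EPS σ)) (f : Ptn → EPS σ) :
    ups (l ++ l') f = ups l' (ups l f) := by
  induction l generalizing f with
  | nil => rfl
  | cons x l ih => exact ih _

theorem downs_append (l l' : List (EPS σ)) (f : Ptn → EPS σ) :
    downs (l ++ l') f = downs l (downs l' f) := by
  induction l with
  | nil => rfl
  | cons x l ih => simp only [List.cons_append, downs, ih]

theorem ups_smul (l : List (EPS σ)) (c : EPS σ) (f : Ptn → EPS σ) :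
    ups l (fun lam => c * f lam) = fun lam => c * ups l f lam := by
  induction l generalizing f with
  | nil => rfl
  | cons x l ih => simp only [ups, up_smul, ih]

theorem downs_smul (l : List (EPS σ)) (c : EPS σ) (f : Ptn → EPS σ) :
    downs l (fun lam => c * f lam) = fun lam => c * downs l f lam := by
  induction l with
  | nil => rfl
  | cons x l ih => simp only [downs, ih, down_smul]

/-- `∏ g (x y)` over the letters `x` of one list and `y` of another. -/
def psiList {A B : Type*} [Mul A] [CommMonoid B] (g : A → B) (l l' : List A) : B :=
  (l.map fun x => (l'.map fun y => g (x * y)).prod).prod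

/-- `∏ g (x)` times `∏ g (x y)` over the letters and pairs of letters of a list. -/
def phiList {A B : Type*} [Mul A] [CommMonoid B] (g : A → B) : List A → B
  | [] => 1
  | x :: l => g x * (l.map fun y => g (x * y)).prod * phiList g l

theorem down_ups (x : EPS σ) (l : List (EPS σ)) (f : Ptn → EPS σ) :
    down x (ups l f) = fun mu => (l.map fun y => geo (x * y)).prod * ups l (down x f) mu := by
  induction l generalizing f with
  | nil => simp [ups]
  | cons y l ih =>
    simp only [ups, ih, down_up, ups_smul, List.map_cons, List.prod_cons]
    funext mu
    ring

theorem downs_up (l : List (EPS σ)) (x : EPS σ) (f : Ptn → EPS σ) :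
    downs l (up x f) = fun mu => (l.map fun y => geo (x * y)).prod * up x (downs l f) mu := by
  induction l with
  | nil => simp [downs]
  | cons y l ih =>
    simp only [downs, ih, down_smul, down_up, List.map_cons, List.prod_cons]
    funext mu
    rw [mul_comm y x]
    ring

theorem downs_ups (l l' : List (EPS σ)) (f : Ptn → EPS σ) :
    downs l (ups l' f) = fun mu => psiList geo l l' * ups l' (downs l f) mu := by
  induction l with
  | nil => simp [downs, psiList]
  | cons x l ih =>
    simp only [downs, ih, down_smul, down_ups, psiList, List.map_cons, List.prod_cons]
    funext mu
    ring

theorem downs_one (l : List (EPS σ)) :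
    downs l (fun _ => 1) = fun mu => phiList geo l * ups l (fun _ => 1) mu := by
  induction l with
  | nil => simp [downs, ups, phiList]
  | cons x l ih =>
    simp only [downs, ih, down_smul, down_ups, down_one, ups_smul, ups, phiList]
    funext mu
    ring

theorem ssum_ups (l : List (EPS σ)) (f : Ptn → EPS σ) :
    ssum (ups l f) = phiList geo l * ssum (downs l f) := by
  induction l generalizing f with
  | nil => simp [downs, ups, phiList]
  | cons x l ih =>
    simp only [ups, ih, downs_up, ← mul_ssum, downs, phiList]
    rw [show (ssum fun mu => up x (downs l f) mu) = ssum (up x (downs l f)) from rfl, ssum_up]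
    ring

theorem strip_mul_pow (t x : EPS σ) (mu lam : Ptn) :
    t ^ lam.size * strip x mu lam = strip (t * x) mu lam * t ^ mu.size := by
  unfold strip
  split_ifs with h
  · have := hstrip_size_le h
    conv_lhs => rw [show lam.size = (lam.size - mu.size) + mu.size by omega]
    rw [Nat.add_sub_cancel]
    ring
  · simp

theorem ups_weight (t : EPS σ) (l : List (EPS σ)) (f : Ptn → EPS σ) :
    (fun lam => t ^ lam.size * ups l f lam)
      = ups (l.map (t * ·)) fun mu => t ^ mu.size * f mu := by
  induction l generalizing f with
  | nil => rfl
  | cons x l ih =>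
    simp only [ups, List.map_cons, ih]
    congr 1
    funext lam
    simp only [up, mul_ssum, ← mul_assoc, strip_mul_pow]

theorem downs_weight (t : EPS σ) (l : List (EPS σ)) (f : Ptn → EPS σ) :
    downs l (fun mu => t ^ mu.size * f mu)
      = fun mu => t ^ mu.size * downs (l.map (t * ·)) f mu := by
  induction l with
  | nil => rfl
  | cons x l ih =>
    simp only [downs, List.map_cons, ih]
    funext mu
    simp only [down, mul_ssum]
    congr 1
    funext lam
    rw [← mul_assoc, mul_comm (strip _ _ _), strip_mul_pow]
    ring

/-- The `t`-weighted sum over all sequences of horizontal strips with weights from a list. -/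
noncomputable def weightedSum (t : EPS σ) (l : List (EPS σ)) : EPS σ :=
  ssum fun lam => t ^ lam.size * ups l (fun _ => 1) lam

theorem weightedSum_step (t : EPS σ) (l : List (EPS σ)) :
    weightedSum t l = phiList geo (l.map (t * ·)) * phiList geo (l.map (t ^ 2 * ·))
      * weightedSum t (l.map (t ^ 2 * ·)) := by
  unfold weightedSum
  have hm : (l.map (t * ·)).map (t * ·) = l.map (t ^ 2 * ·) := by
    rw [List.map_map]
    congr 1
    funext x
    simp only [Function.comp]
    ring
  rw [ups_weight, ssum_ups, downs_weight, hm, downs_one, mul_assoc]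
  simp only [mul_ssum, mul_left_comm]

theorem weightedSum_iterate (t : EPS σ) (l : List (EPS σ)) (n : ℕ) :
    weightedSum t l = (∏ k ∈ Finset.range (2 * n), phiList geo (l.map (t ^ (k + 1) * ·)))
      * weightedSum t (l.map (t ^ (2 * n) * ·)) := by
  induction n with
  | zero => simp
  | succ n ih =>
    rw [ih, weightedSum_step, show 2 * (n + 1) = 2 * n + 1 + 1 by ring, Finset.prod_range_succ,
      Finset.prod_range_succ]
    simp only [List.map_map, Function.comp_def, ← mul_assoc, ← pow_add, ← pow_succ', add_comm 2]

theorem cong_up {d : σ →₀ ℕ} {x : EPS σ} (h : Cong d x 0) (f : Ptn → EPS σ) (lam : Ptn) :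
    Cong d (up x f lam) (f lam) := by
  classical
  have h1 : f lam = ssum fun mu => if mu = lam then f mu else 0 := by
    rw [ssum_eq_single lam _ fun mu hmu => if_neg hmu, if_pos rfl]
  rw [h1]
  refine Cong.ssum fun mu => ?_
  split_ifs with hmu
  · subst hmu
    rw [strip, if_pos (hstrip_refl mu)]
    simpa using Cong.refl (f mu)
  · unfold strip
    split_ifs with hs
    · refine (h.pow_zero fun h0 => hmu (hstrip_eq_of_size hs ?_)).zero_mul _
      omega
    · simpa using Cong.refl _

theorem cong_ups {d : σ →₀ ℕ} {l : List (EPS σ)} (h : ∀ x ∈ l, Cong d x 0) (f : Ptn → EPS σ)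
    (lam : Ptn) : Cong d (ups l f lam) (f lam) := by
  induction l generalizing f with
  | nil => exact Cong.refl _
  | cons x l ih =>
    exact (ih (fun y hy => h y (by simp [hy])) _).trans (cong_up (h x (by simp)) f lam)

theorem cong_weightedSum {d : σ →₀ ℕ} (t : EPS σ) {l : List (EPS σ)} (h : ∀ x ∈ l, Cong d x 0) :
    Cong d (weightedSum t l) (weightedSum t []) :=
  Cong.ssum fun lam => (Cong.refl _).mul (cong_ups h _ lam)

open scoped Classical in
theorem ssum_bounded_parts (t : EPS σ) (K : ℕ) :
    (ssum fun lam : Ptn => if lam.part K = 0 then t ^ lam.size else 0)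
      = ∏ k ∈ Finset.range K, geo (t ^ (k + 1)) := by
  induction K with
  | zero =>
    have h0 : ∀ lam : Ptn, lam.part 0 = 0 → lam = ofParts (fun _ => 0) (fun _ => le_rfl)
        ⟨0, fun _ _ => rfl⟩ := fun lam h => ptn_ext fun i => by
      simpa [h] using part_anti lam (Nat.zero_le i)
    rw [ssum_eq_single (ofParts (fun _ => 0) (fun _ => le_rfl) ⟨0, fun _ _ => rfl⟩) _
      fun lam hlam => if_neg fun h => hlam (h0 lam h), if_pos (by simp),
      size_eq_sum _ (M := 0) fun i _ => by simp]
    simp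
  | succ K ih =>
    rw [Finset.prod_range_succ, ← ih, mul_comm, geo, ssum_mul,
      ← ssum_subtype (fun lam : Ptn => lam.part (K + 1) = 0) _ (fun lam h => if_neg h),
      ← ssum_subtype (fun lam : Ptn => lam.part K = 0) _ (fun lam h => if_neg h)]
    simp only [mul_ssum]
    rw [← ssum_prod (fun p : ℕ × {lam : Ptn // lam.part K = 0} =>
      (t ^ (K + 1)) ^ p.1 * if p.2.1.part K = 0 then t ^ p.2.1.size else 0),
      ← ssum_equiv (removeColumns K)]
    congr 1
    funext lam
    rw [if_pos lam.2, if_pos (removeColumns K lam).2.2, removeColumns_size K lam, pow_add, pow_mul]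

theorem cong_weightedSum_nil {d : σ →₀ ℕ} {t : EPS σ} {K : ℕ}
    (h : ∀ n, K ≤ n → Cong d (t ^ n) 0) :
    Cong d (weightedSum t []) (∏ k ∈ Finset.range K, geo (t ^ (k + 1))) := by
  classical
  rw [← ssum_bounded_parts]
  refine Cong.ssum fun lam => ?_
  simp only [ups, mul_one]
  split_ifs with h0
  · exact Cong.refl _
  · refine h _ ?_
    obtain ⟨M, hM⟩ := exists_part_eq_zero lam
    rw [size_eq_sum lam (M := max M K) fun i hi => hM i (le_trans (le_max_left _ _) hi)]
    calc K = ∑ i ∈ Finset.range K, 1 := by simp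
      _ ≤ ∑ i ∈ Finset.range K, lam.part i := Finset.sum_le_sum fun i hi => by
          have := part_anti lam (Finset.mem_range.1 hi).le
          omega
      _ ≤ _ := Finset.sum_le_sum_of_subset (by
          intro i hi
          simp only [Finset.mem_range] at hi ⊢
          exact lt_of_lt_of_le hi (le_max_right _ _))

end Operators

/-! ### Chains of partitions -/

section Chains

variable {σ : Type*}

open scoped Classical in
/-- The skew Schur function in a finite list of letters, as an iterated sum. -/
noncomputable def stripList : List (EPS σ) → Ptn → Ptn → EPS σ
  | [], mu, lam => if mu = lam then 1 else 0
  | x :: l, mu, lam => ssum fun kap => strip x mu kap * stripList l kap lam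

theorem downs_eq (l : List (EPS σ)) (f : Ptn → EPS σ) (mu : Ptn) :
    downs l f mu = ssum fun lam => stripList l mu lam * f lam := by
  induction l generalizing mu with
  | nil =>
    rw [ssum_eq_single mu _ fun lam h => by simp [stripList, Ne.symm h]]
    simp [stripList, downs]
  | cons x l ih =>
    simp only [downs, down, ih, stripList, mul_ssum, ssum_mul, ← mul_assoc]
    rw [ssum_comm]

theorem ups_eq (l : List (EPS σ)) (f : Ptn → EPS σ) (lam : Ptn) :
    ups l f lam = ssum fun mu => stripList l mu lam * f mu := by
  induction l generalizing f with
  | nil =>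
    rw [ssum_eq_single lam _ fun mu h => by simp [stripList, h]]
    simp [stripList, ups]
  | cons x l ih =>
    simp only [ups, up, ih, stripList, mul_ssum, ssum_mul, ← mul_assoc]
    rw [ssum_comm]
    simp only [mul_comm (strip x _ _)]

theorem finprod_chain {B : Type*} [CommSemiring B] (X : ℕ → B) {c : ℕ → Ptn} {lam : Ptn} {M : ℕ}
    (h : ∀ i, M ≤ i → c i = lam) :
    ∏ᶠ i : ℕ, X i ^ ((c (i + 1)).size - (c i).size)
      = ∏ i ∈ Finset.range M, X i ^ ((c (i + 1)).size - (c i).size) := by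
  refine finprod_eq_prod_of_mulSupport_subset _ fun i hi => ?_
  by_contra hM
  simp only [Finset.coe_range, Set.mem_Iio, not_lt] at hM
  exact hi (by simp [h i hM, h (i + 1) (by omega)])

/-- The skew Schur function as a sum over chains, with coefficients in `ℝ≥0∞`. -/
noncomputable def skewE (X : ℕ → EPS σ) (lam mu : Ptn) : EPS σ :=
  ssum fun c : {c : ℕ → Ptn // IsSchurChain mu lam c} =>
    ∏ᶠ i : ℕ, X i ^ ((c.1 (i + 1)).size - (c.1 i).size)

/-- `c` is a chain from `μ` to `λ` which is constant from index `N` on. -/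
def IsChainUpTo (N : ℕ) (mu lam : Ptn) (c : ℕ → Ptn) : Prop :=
  c 0 = mu ∧ (∀ i, HStrip (c i) (c (i + 1))) ∧ ∀ i, N ≤ i → c i = lam

open scoped Classical in
/-- The sum over the chains which are constant from index `N` on. -/
noncomputable def chainSum (N : ℕ) (X : ℕ → EPS σ) (mu lam : Ptn) : EPS σ :=
  ssum fun c : ℕ → Ptn => if IsChainUpTo N mu lam c then
    ∏ i ∈ Finset.range N, X i ^ ((c (i + 1)).size - (c i).size) else 0

/-- Prepend a term to a sequence. -/
def seqCons {α : Type*} (p : α × (ℕ → α)) : ℕ → α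
  | 0 => p.1
  | n + 1 => p.2 n

/-- A sequence is its first term together with its tail. -/
def seqConsEquiv (α : Type*) : α × (ℕ → α) ≃ (ℕ → α) where
  toFun := seqCons
  invFun c := (c 0, fun n => c (n + 1))
  left_inv _ := rfl
  right_inv c := by
    funext n
    cases n <;> rfl

theorem isChainUpTo_seqCons (N : ℕ) (mu lam a : Ptn) (c : ℕ → Ptn) :
    IsChainUpTo (N + 1) mu lam (seqCons (a, c))
      ↔ a = mu ∧ HStrip mu (c 0) ∧ IsChainUpTo N (c 0) lam c := by
  constructor
  · rintro ⟨rfl, h1, h2⟩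
    exact ⟨rfl, h1 0, rfl, fun i => h1 (i + 1), fun i hi => h2 (i + 1) (by omega)⟩
  · rintro ⟨rfl, h0, -, h1, h2⟩
    refine ⟨rfl, fun i => ?_, fun i hi => ?_⟩
    · rcases i with _ | i
      · exact h0
      · exact h1 i
    · rcases i with _ | i
      · omega
      · exact h2 i (by omega)

theorem chainSum_succ (N : ℕ) (X : ℕ → EPS σ) (mu lam : Ptn) :
    chainSum (N + 1) X mu lam
      = ssum fun kap => strip (X 0) mu kap * chainSum N (fun i => X (i + 1)) kap lam := by
  classical
  simp only [chainSum, mul_ssum]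
  rw [← ssum_equiv (seqConsEquiv Ptn), ssum_prod, ssum_eq_single mu, ssum_comm]
  · congr 1
    funext c
    rw [ssum_eq_single (c 0)]
    · change (if IsChainUpTo (N + 1) mu lam (seqCons (mu, c)) then _ else _) = _
      rw [isChainUpTo_seqCons, strip]
      by_cases h1 : HStrip mu (c 0)
      · by_cases h2 : IsChainUpTo N (c 0) lam c
        · rw [if_pos ⟨rfl, h1, h2⟩, if_pos h1, if_pos h2, Finset.prod_range_succ', mul_comm]
          rfl
        · simp [h2]
      · simp [h1]
    · intro kap h
      rw [if_neg fun h' => h h'.1.symm, mul_zero]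
  · intro a ha
    refine (congrArg ssum (funext fun c => ?_)).trans ssum_zero
    change (if IsChainUpTo (N + 1) mu lam (seqCons (a, c)) then _ else _) = _
    rw [isChainUpTo_seqCons, if_neg fun h => ha h.1]

theorem chainSum_eq (N : ℕ) (X : ℕ → EPS σ) (mu lam : Ptn) :
    chainSum N X mu lam = stripList ((List.range N).map X) mu lam := by
  classical
  induction N generalizing X mu with
  | zero =>
    rw [chainSum, ssum_eq_single fun _ => lam]
    · simp only [List.range_zero, List.map_nil, stripList, Finset.range_zero, Finset.prod_empty]
      refine if_congr ⟨fun h => h.1.symm, fun h => ⟨h.symm, fun _ => hstrip_refl _, fun _ _ => rfl⟩⟩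
        rfl rfl
    · intro c hc
      exact if_neg fun h => hc (funext fun i => h.2.2 i (Nat.zero_le i))
  | succ N ih =>
    rw [chainSum_succ, List.range_succ_eq_map, List.map_cons, List.map_map, stripList]
    simp only [ih]
    rfl

theorem cong_skewE {d : σ →₀ ℕ} {X : ℕ → EPS σ} {N : ℕ} (h : ∀ i, N ≤ i → Cong d (X i) 0)
    (lam mu : Ptn) : Cong d (skewE X lam mu) (stripList ((List.range N).map X) mu lam) := by
  classical
  rw [← chainSum_eq]
  have h0 : skewE X lam mu = ssum fun c : ℕ → Ptn => if IsSchurChain mu lam c then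
      ∏ᶠ i : ℕ, X i ^ ((c (i + 1)).size - (c i).size) else 0 := by
    rw [skewE, ← ssum_subtype (IsSchurChain mu lam) _ fun c hc => if_neg hc]
    congr 1
    funext c
    rw [if_pos c.2]
  rw [h0]
  refine Cong.ssum fun c => ?_
  by_cases h1 : IsSchurChain mu lam c
  · rw [if_pos h1]
    split_ifs with h2
    · rw [finprod_chain X h2.2.2]
      exact Cong.refl _
    · obtain ⟨h3, h4, M, hM⟩ := h1
      rw [finprod_chain X hM]
      have h5 : ∃ i, N ≤ i ∧ c i ≠ c (i + 1) := by
        by_contra! h5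
        refine h2 ⟨h3, h4, fun i hi => ?_⟩
        have h6 : ∀ k, c (i + k) = c i := fun k => by
          induction k with
          | zero => rfl
          | succ k ih => rw [← ih, h5 (i + k) (by omega)]; rfl
        rw [← h6 M, hM _ (by omega)]
      obtain ⟨i, hi, hne⟩ := h5
      refine Cong.prod_zero (i := i) ?_ ((h i hi).pow_zero fun h6 => hne ?_)
      · rw [Finset.mem_range]
        by_contra h6
        exact hne (by rw [hM i (by omega), hM (i + 1) (by omega)])
      · exact hstrip_eq_of_size (h4 i) (by omega)
  · rw [if_neg h1, if_neg fun h2 => h1 ⟨h2.1, h2.2.1, N, h2.2.2⟩]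
    exact Cong.refl _

end Chains

/-! ### Alternating sequences of partitions -/

section Sequences

variable {σ : Type*}

/-- The iterated sum over `λ^0, μ^0, …, λ^{h-1}, μ^{h-1}` with `λ^h` fixed. -/
noncomputable def partialSum (A B : ℕ → Ptn → Ptn → EPS σ) : ℕ → Ptn → EPS σ
  | 0, _ => 1
  | h + 1, lam => ssum fun mu => B h lam mu * ssum fun kap => A h kap mu * partialSum A B h kap

theorem ssum_sequences (A B : ℕ → Ptn → Ptn → EPS σ) (h : ℕ) (g : Ptn → EPS σ) :
    (ssum fun p : (Fin (h + 1) → Ptn) × (Fin h → Ptn) => g (p.1 (Fin.last h)) *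
      ∏ i : Fin h, A i (p.1 i.castSucc) (p.2 i) * B i (p.1 i.succ) (p.2 i))
    = ssum fun lam => g lam * partialSum A B h lam := by
  induction h generalizing g with
  | zero =>
    rw [← ssum_equiv ((Equiv.prodUnique (Fin 1 → Ptn) (Fin 0 → Ptn)).trans
      (Equiv.funUnique (Fin 1) Ptn))]
    congr 1
  | succ h ih =>
    rw [← ssum_equiv ((Fin.snocEquiv fun _ : Fin (h + 2) => Ptn).prodCongr
      (Fin.snocEquiv fun _ : Fin (h + 1) => Ptn)), ssum_prod, ssum_prod]
    congr 1
    funext lam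
    simp only [ssum_prod, Equiv.prodCongr_apply, Prod.map, Fin.snocEquiv_apply]
    rw [ssum_comm, partialSum, mul_ssum]
    congr 1
    funext mu
    rw [← ih, mul_ssum, mul_ssum, ssum_prod]
    congr 1
    funext p
    congr 1
    funext q
    simp only [Fin.snoc_last, Fin.prod_univ_castSucc, Fin.snoc_castSucc, Fin.succ_castSucc,
      Fin.succ_last, Fin.val_castSucc, Fin.val_last]
    ring

/-- Concatenation of the first `h` lists, the last one first. -/
def concatRev {α : Type*} (L : ℕ → List α) : ℕ → List α
  | 0 => []
  | h + 1 => L h ++ concatRev L h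

/-- Concatenation of the first `h` lists. -/
def concat {α : Type*} (L : ℕ → List α) : ℕ → List α
  | 0 => []
  | h + 1 => concat L h ++ L h

theorem partialSum_eq (X Y : ℕ → List (EPS σ)) (h : ℕ) :
    partialSum (fun i lam mu => stripList (X i) mu lam) (fun i lam mu => stripList (Y i) mu lam) h
      = fun lam => (∏ j ∈ Finset.range h, psiList geo (X j) (concat Y j)) *
        ups (concat Y h) (downs (concatRev X h) fun _ => 1) lam := by
  induction h with
  | zero =>
    funext lam
    simp [partialSum, concat, concatRev, ups, downs]
  | succ h ih =>
    have h1 : partialSum (fun i lam mu => stripList (X i) mu lam)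
        (fun i lam mu => stripList (Y i) mu lam) (h + 1)
        = ups (Y h) (downs (X h) (partialSum (fun i lam mu => stripList (X i) mu lam)
          (fun i lam mu => stripList (Y i) mu lam) h)) := by
      funext lam
      simp only [ups_eq, downs_eq, partialSum]
    rw [h1, ih]
    simp only [downs_smul, ups_smul, downs_ups, concat, concatRev, ups_append, downs_append,
      Finset.prod_range_succ, mul_assoc]

theorem finite_summation (t : EPS σ) (X Y : ℕ → List (EPS σ)) (h : ℕ) :
    (ssum fun p : (Fin (h + 1) → Ptn) × (Fin h → Ptn) => t ^ (p.1 (Fin.last h)).size *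
      ∏ i : Fin h, stripList (X i) (p.2 i) (p.1 i.castSucc)
        * stripList (Y i) (p.2 i) (p.1 i.succ))
    = (∏ j ∈ Finset.range h, psiList geo (X j) (concat Y j)) * phiList geo (concatRev X h) *
        weightedSum t (concatRev X h ++ concat Y h) := by
  rw [ssum_sequences (fun i lam mu => stripList (X i) mu lam)
    (fun i lam mu => stripList (Y i) mu lam) h fun lam => t ^ lam.size, partialSum_eq,
    weightedSum, mul_ssum]
  simp only [downs_one, ups_smul, ups_append]
  congr 1
  funext lam
  ring

end Sequences

/-! ### Transfer from `ℝ≥0∞` to `ℚ` -/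

section Transfer

variable {σ : Type*}

/-- `f` and `F` have the same coefficients, and these are natural numbers. -/
def Rel (f : MvPowerSeries σ ℚ) (F : EPS σ) : Prop :=
  ∃ g : MvPowerSeries σ ℕ, MvPowerSeries.map (Nat.castRingHom ℚ) g = f ∧
    MvPowerSeries.map (Nat.castRingHom ENNReal) g = F

theorem rel_iff {f : MvPowerSeries σ ℚ} {F : EPS σ} :
    Rel f F ↔ ∀ d, ∃ n : ℕ, MvPowerSeries.coeff d f = n ∧ MvPowerSeries.coeff d F = n := by
  constructor
  · rintro ⟨g, rfl, rfl⟩ d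
    exact ⟨MvPowerSeries.coeff d g, by simp, by simp⟩
  · intro h
    choose g hg using h
    exact ⟨g, MvPowerSeries.ext fun d => (hg d).1.symm, MvPowerSeries.ext fun d => (hg d).2.symm⟩

theorem exists_rel {F : EPS σ} (h : ∀ d, ∃ n : ℕ, MvPowerSeries.coeff d F = n) :
    ∃ f, Rel f F := by
  choose g hg using h
  exact ⟨_, g, rfl, MvPowerSeries.ext fun d => (hg d).symm⟩

theorem Rel.unique {f f' : MvPowerSeries σ ℚ} {F : EPS σ} (h : Rel f F) (h' : Rel f' F) :
    f = f' := by
  ext d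
  obtain ⟨n, h1, h2⟩ := rel_iff.1 h d
  obtain ⟨m, h3, h4⟩ := rel_iff.1 h' d
  rw [h2] at h4
  rw [h1, h3, Nat.cast_inj.1 h4]

theorem Rel.one : Rel (1 : MvPowerSeries σ ℚ) 1 := ⟨1, map_one _, map_one _⟩

theorem rel_X (s : σ) : Rel (MvPowerSeries.X s) (MvPowerSeries.X s) :=
  ⟨MvPowerSeries.X s, MvPowerSeries.map_X _ _, MvPowerSeries.map_X _ _⟩

variable {f f' : MvPowerSeries σ ℚ} {F F' : EPS σ}

theorem Rel.add (h : Rel f F) (h' : Rel f' F') : Rel (f + f') (F + F') := by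
  obtain ⟨g, rfl, rfl⟩ := h
  obtain ⟨g', rfl, rfl⟩ := h'
  exact ⟨g + g', map_add _ _ _, map_add _ _ _⟩

theorem Rel.zero : Rel (0 : MvPowerSeries σ ℚ) 0 := ⟨0, map_zero _, map_zero _⟩

theorem Rel.mul (h : Rel f F) (h' : Rel f' F') : Rel (f * f') (F * F') := by
  obtain ⟨g, rfl, rfl⟩ := h
  obtain ⟨g', rfl, rfl⟩ := h'
  exact ⟨g * g', map_mul _ _ _, map_mul _ _ _⟩

theorem Rel.pow (h : Rel f F) (n : ℕ) : Rel (f ^ n) (F ^ n) := by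
  obtain ⟨g, rfl, rfl⟩ := h
  exact ⟨g ^ n, map_pow _ _ _, map_pow _ _ _⟩

theorem Rel.prod {ι : Type*} {s : Finset ι} {u : ι → MvPowerSeries σ ℚ} {U : ι → EPS σ}
    (h : ∀ i ∈ s, Rel (u i) (U i)) : Rel (∏ i ∈ s, u i) (∏ i ∈ s, U i) := by
  classical
  induction s using Finset.induction_on with
  | empty => exact Rel.one
  | insert a s ha ih =>
    rw [Finset.prod_insert ha, Finset.prod_insert ha]
    exact (h a (by simp)).mul (ih fun i hi => h i (by simp [hi]))

theorem Rel.sum {ι : Type*} {s : Finset ι} {u : ι → MvPowerSeries σ ℚ} {U : ι → EPS σ}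
    (h : ∀ i ∈ s, Rel (u i) (U i)) : Rel (∑ i ∈ s, u i) (∑ i ∈ s, U i) := by
  classical
  induction s using Finset.induction_on with
  | empty => exact Rel.zero
  | insert a s ha ih =>
    rw [Finset.sum_insert ha, Finset.sum_insert ha]
    exact (h a (by simp)).add (ih fun i hi => h i (by simp [hi]))

theorem Rel.listProd {ι : Type*} {l : List ι} {u : ι → MvPowerSeries σ ℚ} {U : ι → EPS σ}
    (h : ∀ i ∈ l, Rel (u i) (U i)) : Rel (l.map u).prod (l.map U).prod := by
  induction l with
  | nil => exact Rel.one
  | cons a l ih =>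
    rw [List.map_cons, List.map_cons, List.prod_cons, List.prod_cons]
    exact (h a (by simp)).mul (ih fun i hi => h i (by simp [hi]))

theorem Rel.exists_geo (h : Rel f F) (h0 : MvPowerSeries.constantCoeff f = 0) :
    ∃ g, Rel g (geo F) := by
  have h1 : MvPowerSeries.constantCoeff F = 0 := by
    obtain ⟨n, h2, h3⟩ := rel_iff.1 h 0
    rw [MvPowerSeries.coeff_zero_eq_constantCoeff_apply] at h2 h3
    rw [h0, eq_comm, Nat.cast_eq_zero] at h2
    rw [h3, h2, Nat.cast_zero]
  refine exists_rel fun d => ?_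
  have h2 : ∀ k, ∃ n : ℕ, (MvPowerSeries.coeff d (F ^ k) : ENNReal) = n := fun k => by
    obtain ⟨n, -, h3⟩ := rel_iff.1 (h.pow k) d
    exact ⟨n, h3⟩
  choose n hn using h2
  refine ⟨∑ k ∈ Finset.range (d.degree + 1), n k, ?_⟩
  rw [geo, coeff_ssum, tsum_eq_sum (s := Finset.range (d.degree + 1)), Nat.cast_sum]
  · exact Finset.sum_congr rfl fun k _ => hn k
  · intro k hk
    refine MvPowerSeries.coeff_eq_zero_of_constantCoeff_nilpotent (m := 1) ?_ ?_
    · rw [h1, pow_one]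
    · rw [Finset.mem_range] at hk
      omega

theorem Rel.geo (h : Rel f F) (h0 : MvPowerSeries.constantCoeff f = 0) :
    Rel (1 - f)⁻¹ (geo F) := by
  obtain ⟨g, hg⟩ := h.exists_geo h0
  have h1 : g = 1 + f * g := by
    refine hg.unique ?_
    rw [geo_eq]
    exact Rel.one.add (h.mul hg)
  have h2 : (1 - f)⁻¹ = g := by
    rw [eq_comm, MvPowerSeries.eq_inv_iff_mul_eq_one (by simp [h0])]
    linear_combination h1
  rwa [h2]

theorem cong_inv_one {d : σ →₀ ℕ} (h0 : MvPowerSeries.constantCoeff f = 0) (h : Cong d f 0) :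
    Cong d (1 - f)⁻¹ 1 := by
  have h1 : (1 - f)⁻¹ = 1 + f * (1 - f)⁻¹ := by
    have h2 := MvPowerSeries.inv_mul_cancel (1 - f) (by simp [h0])
    linear_combination h2
  rw [h1]
  simpa using (Cong.refl (d := d) (1 : MvPowerSeries σ ℚ)).add (h.zero_mul _)

theorem Rel.psiList {ι κ : Type*} {l : List ι} {l' : List κ} {u : ι → MvPowerSeries σ ℚ}
    {U : ι → EPS σ} {v : κ → MvPowerSeries σ ℚ} {V : κ → EPS σ} (h : ∀ i, Rel (u i) (U i))
    (h' : ∀ i, Rel (v i) (V i)) (h0 : ∀ i, MvPowerSeries.constantCoeff (u i) = 0) :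
    Rel (psiList (fun m => (1 - m)⁻¹) (l.map u) (l'.map v))
      (psiList CompleteSummation.geo (l.map U) (l'.map V)) := by
  simp only [CompleteSummation.psiList, List.map_map]
  refine Rel.listProd fun i _ => ?_
  simp only [Function.comp]
  exact Rel.listProd fun j _ => ((h i).mul (h' j)).geo (by simp [h0])

theorem Rel.phiList {ι : Type*} {l : List ι} {u : ι → MvPowerSeries σ ℚ}
    {U : ι → EPS σ} (h : ∀ i, Rel (u i) (U i))
    (h0 : ∀ i, MvPowerSeries.constantCoeff (u i) = 0) :
    Rel (phiList (fun m => (1 - m)⁻¹) (l.map u))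
      (phiList CompleteSummation.geo (l.map U)) := by
  induction l with
  | nil => exact Rel.one
  | cons i l ih =>
    simp only [List.map_cons, CompleteSummation.phiList, List.map_map]
    refine (((h i).geo (h0 i)).mul (Rel.listProd fun j _ => ?_)).mul ih
    exact ((h i).mul (h j)).geo (by simp [h0])

theorem Rel.strip {x : MvPowerSeries σ ℚ} {y : EPS σ} (h : Rel x y) (mu lam : Ptn) :
    ∃ u, Rel u (strip y mu lam) := by
  unfold CompleteSummation.strip
  split_ifs
  · exact ⟨_, h.pow _⟩
  · exact ⟨_, Rel.zero⟩

theorem exists_rel_ups {l : List (EPS σ)} (hl : ∀ x ∈ l, ∃ u, Rel u x) {f : Ptn → EPS σ}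
    (hf : ∀ mu, ∃ u, Rel u (f mu)) (lam : Ptn) : ∃ u, Rel u (ups l f lam) := by
  induction l generalizing f with
  | nil => exact hf lam
  | cons x l ih =>
    refine ih (fun y hy => hl y (by simp [hy])) fun nu => ?_
    obtain ⟨u, hu⟩ := hl x (by simp)
    choose v hv using fun mu => hu.strip mu nu
    choose w hw using hf
    rw [up, ssum_eq_sum (finite_hstrip_le nu).toFinset]
    · exact ⟨_, Rel.sum fun mu _ => (hv mu).mul (hw mu)⟩
    · intro mu hmu
      rw [Set.Finite.mem_toFinset, Set.mem_ofPred_eq] at hmu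
      rw [CompleteSummation.strip, if_neg hmu, zero_mul]

theorem exists_rel_stripList {l : List (EPS σ)} (hl : ∀ x ∈ l, ∃ u, Rel u x) (mu lam : Ptn) :
    ∃ u, Rel u (stripList l mu lam) := by
  classical
  have h : stripList l mu lam = ups l (fun nu => if nu = mu then 1 else 0) lam := by
    rw [ups_eq, ssum_eq_single mu _ fun nu h => by simp [h]]
    simp
  rw [h]
  refine exists_rel_ups hl (fun nu => ?_) lam
  split_ifs
  · exact ⟨_, Rel.one⟩
  · exact ⟨_, Rel.zero⟩

/-! ### Infinite sums and products of rational power series -/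

instance : T2Space (MvPowerSeries σ ℚ) := inferInstanceAs (T2Space ((σ →₀ ℕ) → ℚ))

theorem hasSum_of_rel {ι : Type*} {u : ι → MvPowerSeries σ ℚ} {U : ι → EPS σ}
    {g : MvPowerSeries σ ℚ} (hu : ∀ i, Rel (u i) (U i)) (hg : Rel g (ssum U)) : HasSum u g := by
  have h : ∀ d, HasSum (fun i => MvPowerSeries.coeff d (u i)) (MvPowerSeries.coeff d g) := by
    intro d
    choose n hn using fun i => rel_iff.1 (hu i) d
    obtain ⟨m, hm1, hm2⟩ := rel_iff.1 hg d
    rw [coeff_ssum] at hm2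
    simp only [(hn _).2] at hm2
    have hfin : {i | 1 ≤ (n i : ENNReal)}.Finite :=
      (ENNReal.finite_const_le_of_tsum_ne_top (by rw [hm2]; exact ENNReal.natCast_ne_top m)
        one_ne_zero)
    have h0 : ∀ i ∉ hfin.toFinset, n i = 0 := fun i hi => by
      by_contra h
      exact hi (hfin.mem_toFinset.2 (by
        rw [Set.mem_ofPred_eq]
        exact_mod_cast Nat.one_le_iff_ne_zero.2 h))
    rw [tsum_eq_sum (s := hfin.toFinset) fun i hi => by rw [h0 i hi, Nat.cast_zero]] at hm2
    rw [hm1, ← Nat.cast_inj.1 (by rw [Nat.cast_sum]; exact hm2 :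
      ((∑ i ∈ hfin.toFinset, n i : ℕ) : ENNReal) = (m : ENNReal)), Nat.cast_sum]
    simp only [(hn _).1]
    exact hasSum_sum_of_ne_finset_zero fun i hi => by rw [h0 i hi, Nat.cast_zero]
  exact Pi.hasSum.2 h

theorem cong_tprod {ι : Type*} {u : ι → MvPowerSeries σ ℚ}
    (hu : ∀ e, ∃ T : Finset ι, ∀ i ∉ T, Cong e (u i) 1) {d : σ →₀ ℕ} {T : Finset ι}
    (hT : ∀ i ∉ T, Cong d (u i) 1) : Cong d (∏' i, u i) (∏ i ∈ T, u i) := by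
  classical
  have key : ∀ {e : σ →₀ ℕ} {T T' : Finset ι}, (∀ i ∉ T, Cong e (u i) 1) → T ⊆ T' →
      Cong e (∏ i ∈ T', u i) (∏ i ∈ T, u i) := by
    intro e T T' h hTT
    rw [← Finset.prod_sdiff hTT]
    have h1 : Cong e (∏ i ∈ T' \ T, u i) (∏ i ∈ T' \ T, 1) :=
      Cong.prod fun i hi => h i (Finset.mem_sdiff.1 hi).2
    simpa using h1.mul (Cong.refl _)
  choose S hS using hu
  let g : MvPowerSeries σ ℚ := fun e => MvPowerSeries.coeff e (∏ i ∈ S e, u i)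
  have hg : HasProd u g := by
    refine tendsto_pi_nhds.2 fun e => ?_
    refine tendsto_const_nhds.congr' ?_
    rw [SummationFilter.unconditional_filter]
    filter_upwards [Filter.eventually_ge_atTop (S e)] with T' hT'
    exact (key (hS e) hT').coeff_eq.symm
  rw [hg.tprod_eq]
  intro e he
  change MvPowerSeries.coeff e (∏ i ∈ S e, u i) = _
  rw [← (key (hS e) Finset.subset_union_left).coeff_eq,
    (key (fun i hi => (hT i hi).mono he) (Finset.subset_union_right (s₁ := S e))).coeff_eq]

end Transfer

/-! ### Rearranging products over letters -/

section Products

theorem phiList_perm {A B : Type*} [CommSemigroup A] [CommMonoid B] (g : A → B) {l l' : List A}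
    (h : l.Perm l') : phiList g l = phiList g l' := by
  induction h with
  | nil => rfl
  | cons x h ih => simp only [phiList, ih, (h.map _).prod_eq]
  | swap x y l =>
    simp only [phiList, List.map_cons, List.prod_cons, mul_comm y x]
    ac_rfl
  | trans _ _ ih ih' => exact ih.trans ih'

theorem phiList_concat {A B : Type*} [CommSemigroup A] [CommMonoid B] (g : A → B) (l : List A)
    (x : A) : phiList g (l ++ [x]) = phiList g l * (g x * (l.map fun y => g (y * x)).prod) := by
  induction l with
  | nil => simp [phiList]
  | cons a l ih =>
    simp only [List.cons_append, phiList, ih, List.map_append, List.map_cons, List.map_nil,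
      List.prod_append, List.prod_cons, List.prod_nil, mul_one]
    ac_rfl

theorem prod_range_lt {B : Type*} [CommMonoid B] (M : ℕ) (f : ℕ → ℕ → B) :
    ∏ p ∈ (Finset.range M ×ˢ Finset.range M).filter (fun p => p.1 < p.2), f p.1 p.2
      = ∏ j ∈ Finset.range M, ∏ i ∈ Finset.range j, f i j := by
  rw [Finset.prod_filter, Finset.prod_product_right]
  refine Finset.prod_congr rfl fun j hj => ?_
  rw [← Finset.prod_filter]
  refine Finset.prod_congr ?_ fun _ _ => rfl
  ext i
  simp only [Finset.mem_filter, Finset.mem_range] at hj ⊢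
  omega

theorem prod_fin_lt {B : Type*} [CommMonoid B] (h : ℕ) (f : ℕ → ℕ → B) :
    ∏ q ∈ Finset.univ.filter (fun q : Fin h × Fin h => q.1 < q.2), f q.1 q.2
      = ∏ j ∈ Finset.range h, ∏ i ∈ Finset.range j, f i j := by
  rw [← prod_range_lt, Finset.prod_filter, Finset.prod_filter, Fintype.prod_prod_type,
    Finset.prod_product, Finset.prod_range]
  refine Finset.prod_congr rfl fun i _ => ?_
  rw [Finset.prod_range]
  rfl

theorem phiList_range {A B : Type*} [CommSemigroup A] [CommMonoid B] (g : A → B) (u : ℕ → A)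
    (M : ℕ) : phiList g ((List.range M).map u) = (∏ i ∈ Finset.range M, g (u i)) *
      ∏ p ∈ (Finset.range M ×ˢ Finset.range M).filter (fun p => p.1 < p.2),
        g (u p.1 * u p.2) := by
  rw [prod_range_lt M fun i j => g (u i * u j)]
  induction M with
  | zero => simp [phiList]
  | succ M ih =>
    rw [List.range_succ, List.map_append, List.map_singleton, phiList_concat, ih,
      Finset.prod_range_succ, Finset.prod_range_succ, List.map_map]
    have h : ((List.range M).map ((fun y => g (y * u M)) ∘ u)).prod
        = ∏ i ∈ Finset.range M, g (u i * u M) := by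
      rw [Finset.prod_eq_multiset_prod, Finset.range_val, ← Multiset.coe_range,
        Multiset.map_coe, Multiset.prod_coe]
      rfl
    rw [h]
    ac_rfl

theorem psiList_range {A B : Type*} [Mul A] [CommMonoid B] (g : A → B) (u v : ℕ → A)
    (M N : ℕ) : psiList g ((List.range M).map u) ((List.range N).map v)
      = ∏ i ∈ Finset.range M, ∏ j ∈ Finset.range N, g (u i * v j) := by
  have h : ∀ (K : ℕ) (w : ℕ → B), ((List.range K).map w).prod = ∏ i ∈ Finset.range K, w i := by
    intro K w
    rw [Finset.prod_eq_multiset_prod, Finset.range_val, ← Multiset.coe_range,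
      Multiset.map_coe, Multiset.prod_coe]
  rw [psiList, List.map_map, h]
  refine Finset.prod_congr rfl fun i _ => ?_
  rw [Function.comp, List.map_map, h]
  rfl

theorem psiList_concat {A B : Type*} [Mul A] [CommMonoid B] (g : A → B) (l : List A)
    (L : ℕ → List A) (h : ℕ) :
    psiList g l (concat L h) = ∏ i ∈ Finset.range h, psiList g l (L i) := by
  induction h with
  | zero => simp [psiList, concat]
  | succ h ih =>
    rw [Finset.prod_range_succ, ← ih, concat]
    simp only [psiList, List.map_append, List.prod_append, List.prod_map_mul]

theorem map_concat {α β : Type*} (f : α → β) (L : ℕ → List α) (h : ℕ) :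
    (concat L h).map f = concat (fun i => (L i).map f) h := by
  induction h with
  | zero => rfl
  | succ h ih => rw [concat, concat, List.map_append, ih]

theorem map_concatRev {α β : Type*} (f : α → β) (L : ℕ → List α) (h : ℕ) :
    (concatRev L h).map f = concatRev (fun i => (L i).map f) h := by
  induction h with
  | zero => rfl
  | succ h ih => rw [concatRev, concatRev, List.map_append, ih]

theorem concat_perm {α : Type*} (L : ℕ → List α) (h : ℕ) :
    (concat L h).Perm (concatRev L h) := by
  induction h with
  | zero => exact List.Perm.refl _
  | succ h ih => exact List.perm_append_comm.trans (ih.append_left _)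

theorem mem_concat {α : Type*} {L : ℕ → List α} {h : ℕ} {a : α} :
    a ∈ concat L h ↔ ∃ i < h, a ∈ L i := by
  induction h with
  | zero => simp [concat]
  | succ h ih => simp only [concat, List.mem_append, ih, Nat.lt_succ_iff_lt_or_eq, or_and_right,
      exists_or, exists_eq_left]

theorem nodup_concat {α : Type*} {L : ℕ → List α} (hL : ∀ i, (L i).Nodup)
    (hd : ∀ i j a, a ∈ L i → a ∈ L j → i = j) (h : ℕ) : (concat L h).Nodup := by
  induction h with
  | zero => exact List.nodup_nil
  | succ h ih =>
    refine List.nodup_append'.2 ⟨ih, hL h, fun a h1 h2 => ?_⟩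
    obtain ⟨i, hi, h3⟩ := mem_concat.1 h1
    exact hi.ne (hd i h a h3 h2)

end Products

/-! ### The alphabets -/

section Alphabets

/-- The index set of the variables. -/
abbrev Idx : Type := (Bool × ℕ × ℕ) ⊕ Unit

/-- The first `N` variables of an alphabet. -/
def letters (b : Bool) (N i : ℕ) : List Idx := (List.range N).map fun n => Sum.inl (b, i, n)

theorem mem_concat_letters {b : Bool} {N h : ℕ} {s : Idx} :
    s ∈ concat (letters b N) h ↔ ∃ i < h, ∃ n < N, Sum.inl (b, i, n) = s := by
  simp [mem_concat, letters]

theorem nodup_concat_letters (b : Bool) (N h : ℕ) : (concat (letters b N) h).Nodup := by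
  refine nodup_concat (fun i => ?_) (fun i j a hi hj => ?_) h
  · refine List.Nodup.map (fun m n h => ?_) List.nodup_range
    simpa using h
  · simp only [letters, List.mem_map] at hi hj
    obtain ⟨m, -, rfl⟩ := hi
    obtain ⟨n, -, h⟩ := hj
    simp only [Sum.inl.injEq, Prod.mk.injEq] at h
    exact h.2.1.symm

theorem exists_bound (d : Idx →₀ ℕ) : ∃ N, ∀ b i n, N ≤ n → d (Sum.inl (b, i, n)) = 0 := by
  refine ⟨(d.support.sup fun s => Sum.elim (fun t => t.2.2) (fun _ => 0) s) + 1,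
    fun b i n hn => ?_⟩
  by_contra h
  have := Finset.le_sup (f := fun s : Idx => Sum.elim (fun t => t.2.2) (fun _ => 0) s)
    (Finsupp.mem_support_iff.2 h)
  simp only [Sum.elim_inl] at this
  omega

theorem unionA_eq {h : ℕ} (hh : h ≠ 0) (A : ℕ → ℕ → R1) (n : ℕ) :
    unionA h A n = A (n % h) (n / h) := if_neg hh

theorem cong_unionA {d : Idx →₀ ℕ} {N h n : ℕ} {A : ℕ → ℕ → R1}
    (hA : ∀ i n, N ≤ n → Cong d (A i n) 0) (hn : h * N ≤ n) : Cong d (unionA h A n) 0 := by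
  rcases Nat.eq_zero_or_pos h with rfl | hh
  · exact Cong.refl _
  · rw [unionA_eq hh.ne']
    exact hA _ _ ((Nat.le_div_iff_mul_le hh).2 (by rwa [mul_comm]))

theorem cong_unionXY {d : Idx →₀ ℕ} {N h n : ℕ}
    (hN : ∀ b i n, N ≤ n → d (Sum.inl (b, i, n)) = 0) (hn : 2 * (h * N) ≤ n) :
    Cong d (unionXY h n) 0 := by
  unfold unionXY
  split_ifs
  · exact cong_unionA (fun i n hn => cong_X_zero (hN _ _ _ hn)) (by omega)
  · exact cong_unionA (fun i n hn => cong_X_zero (hN _ _ _ hn)) (by omega)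

theorem constantCoeff_unionA (h n : ℕ) {A : ℕ → ℕ → R1}
    (hA : ∀ i n, MvPowerSeries.constantCoeff (A i n) = 0) :
    MvPowerSeries.constantCoeff (unionA h A n) = 0 := by
  unfold unionA
  split_ifs
  · exact map_zero _
  · exact hA _ _

theorem unionA_index_perm {h : ℕ} (hh : 0 < h) (b : Bool) (N : ℕ) :
    ((List.range (h * N)).map fun n => (Sum.inl (b, n % h, n / h) : Idx)).Perm
      (concat (letters b N) h) := by
  rw [List.perm_ext_iff_of_nodup _ (nodup_concat_letters b N h)]
  · intro s
    rw [mem_concat_letters, List.mem_map]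
    constructor
    · rintro ⟨n, hn, rfl⟩
      exact ⟨n % h, Nat.mod_lt _ hh, n / h, Nat.div_lt_of_lt_mul (List.mem_range.1 hn), rfl⟩
    · rintro ⟨i, hi, n, hn, rfl⟩
      refine ⟨i + h * n, List.mem_range.2 ?_, ?_⟩
      · nlinarith
      · rw [Nat.add_mul_mod_self_left, Nat.mod_eq_of_lt hi, Nat.add_mul_div_left _ _ hh,
          Nat.div_eq_of_lt hi, zero_add]
  · refine List.Nodup.map (fun m n h => ?_) List.nodup_range
    simp only [Sum.inl.injEq, Prod.mk.injEq] at h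
    rw [← Nat.div_add_mod m, ← Nat.div_add_mod n, h.2.1, h.2.2]

theorem unionA_perm (h N : ℕ) (b : Bool) {A : ℕ → ℕ → R1}
    (hA : ∀ i n, A i n = MvPowerSeries.X (Sum.inl (b, i, n))) :
    ((List.range (h * N)).map (unionA h A)).Perm
      ((concat (letters b N) h).map fun s => (MvPowerSeries.X s : R1)) := by
  rcases Nat.eq_zero_or_pos h with rfl | hh
  · simp [concat]
  · refine List.Perm.trans (.of_eq ?_) ((unionA_index_perm hh b N).map _)
    rw [List.map_map]
    refine List.map_congr_left fun n _ => ?_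
    rw [unionA_eq hh.ne', hA]
    rfl

theorem map_range_two_mul_perm {α : Type*} (u v : ℕ → α) (M : ℕ) :
    ((List.range (2 * M)).map fun n => if n % 2 = 0 then u (n / 2) else v (n / 2)).Perm
      ((List.range M).map u ++ (List.range M).map v) := by
  induction M with
  | zero => simp
  | succ M ih =>
    rw [show 2 * (M + 1) = 2 * M + 1 + 1 by ring, List.range_succ, List.range_succ,
      List.range_succ]
    simp only [List.map_append, List.map_singleton, List.append_assoc]
    rw [if_pos (by omega), if_neg (by omega), show 2 * M / 2 = M by omega,
      show (2 * M + 1) / 2 = M by omega]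
    refine (ih.append_right _).trans ?_
    rw [List.append_assoc]
    refine List.Perm.append_left _ ?_
    rw [← List.append_assoc, ← List.append_assoc]
    exact List.perm_append_comm.append_right _

theorem unionXY_perm (h N : ℕ) :
    ((List.range (2 * (h * N))).map (unionXY h)).Perm
      ((concatRev (letters false N) h ++ concat (letters true N) h).map
        fun s => (MvPowerSeries.X s : R1)) := by
  refine (map_range_two_mul_perm (unionA h Xa) (unionA h Ya) (h * N)).trans ?_
  rw [List.map_append]
  exact ((unionA_perm h N false fun _ _ => rfl).trans ((concat_perm _ _).map _)).append
    (unionA_perm h N true fun _ _ => rfl)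

end Alphabets

/-! ### Truncation of the infinite products -/

section Truncation

variable {d : Idx →₀ ℕ}

theorem cong_Phi {u : ℕ → R1} (h0 : ∀ n, MvPowerSeries.constantCoeff (u n) = 0)
    (hu : ∀ e, ∃ M, ∀ n, M ≤ n → Cong e (u n) 0) {M : ℕ} (hM : ∀ n, M ≤ n → Cong d (u n) 0) :
    Cong d (Phi u) (phiList (fun m => (1 - m)⁻¹) ((List.range M).map u)) := by
  have h1 : ∀ e M, (∀ n, M ≤ n → Cong e (u n) 0) →
      ∀ i ∉ Finset.range M, Cong e (1 - u i)⁻¹ 1 := fun e M h i hi =>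
    cong_inv_one (h0 i) (h i (by simpa using hi))
  have h2 : ∀ e M, (∀ n, M ≤ n → Cong e (u n) 0) →
      ∀ p ∉ Finset.subtype (fun q : ℕ × ℕ => q.1 < q.2) (Finset.range M ×ˢ Finset.range M),
        Cong e (1 - u p.1.1 * u p.1.2)⁻¹ 1 := fun e M h p hp => by
    have hp' : ¬ (p.1.1 < M ∧ p.1.2 < M) := by simpa using hp
    have := p.2
    refine cong_inv_one (by simp [h0]) (Cong.mul_zero _ (h _ ?_))
    omega
  rw [phiList_range]
  refine Cong.mul (cong_tprod (fun e => ?_) (h1 d M hM)) ?_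
  · obtain ⟨M', hM'⟩ := hu e
    exact ⟨_, h1 e M' hM'⟩
  · have h3 := cong_tprod (u := fun p : {q : ℕ × ℕ // q.1 < q.2} => (1 - u p.1.1 * u p.1.2)⁻¹)
      (fun e => by
        obtain ⟨M', hM'⟩ := hu e
        exact ⟨_, h2 e M' hM'⟩) (h2 d M hM)
    rwa [Finset.prod_subtype_eq_prod_filter (f := fun p : ℕ × ℕ => (1 - u p.1 * u p.2)⁻¹)] at h3

theorem cong_Psi {u v : ℕ → R1} (h0 : ∀ n, MvPowerSeries.constantCoeff (u n) = 0)
    (hu : ∀ e, ∃ M, ∀ n, M ≤ n → Cong e (u n) 0 ∧ Cong e (v n) 0) {M : ℕ}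
    (hM : ∀ n, M ≤ n → Cong d (u n) 0 ∧ Cong d (v n) 0) :
    Cong d (Psi u v)
      (psiList (fun m => (1 - m)⁻¹) ((List.range M).map v) ((List.range M).map u)) := by
  have h1 : ∀ e M, (∀ n, M ≤ n → Cong e (u n) 0 ∧ Cong e (v n) 0) →
      ∀ p ∉ Finset.range M ×ˢ Finset.range M, Cong e (1 - u p.1 * v p.2)⁻¹ 1 :=
    fun e M h p hp => by
    refine cong_inv_one (by simp [h0]) ?_
    by_cases h2 : M ≤ p.1
    · exact (h _ h2).1.zero_mul _
    · refine Cong.mul_zero _ (h _ ?_).2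
      by_contra h3
      exact hp (by simp; omega)
  rw [psiList_range, Finset.prod_comm, ← Finset.prod_product']
  simp only [mul_comm (v _)]
  refine cong_tprod (fun e => ?_) (h1 d M hM)
  obtain ⟨M', hM'⟩ := hu e
  exact ⟨_, h1 e M' hM'⟩

/-- The truncated product side of the summation formula. -/
noncomputable def truncatedProduct {A : Type*} [CommSemiring A]
    (g : MvPowerSeries Idx A → MvPowerSeries Idx A) (h N K : ℕ) : MvPowerSeries Idx A :=
  (∏ j ∈ Finset.range h, psiList g ((letters false N j).map MvPowerSeries.X)
      ((concat (letters true N) j).map MvPowerSeries.X)) *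
    phiList g ((concatRev (letters false N) h).map MvPowerSeries.X) *
    ∏ k ∈ Finset.range K,
      phiList g ((concatRev (letters false N) h ++ concat (letters true N) h).map
        fun s => MvPowerSeries.X (Sum.inr ()) ^ (k + 1) * MvPowerSeries.X s) *
      g (MvPowerSeries.X (Sum.inr ()) ^ (k + 1))

theorem rel_truncatedProduct (h N K : ℕ) :
    Rel (truncatedProduct (fun m => (1 - m)⁻¹) h N K) (truncatedProduct geo h N K) := by
  have h0 : ∀ s : Idx, MvPowerSeries.constantCoeff (MvPowerSeries.X s : MvPowerSeries Idx ℚ) = 0 :=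
    fun s => MvPowerSeries.constantCoeff_X s
  refine ((Rel.prod fun j _ => Rel.psiList rel_X rel_X h0).mul (Rel.phiList rel_X h0)).mul
    (Rel.prod fun k _ => (Rel.phiList (fun s => ((rel_X _).pow _).mul (rel_X s)) fun s => ?_).mul
      (((rel_X _).pow _).geo ?_))
  · rw [map_mul, h0, mul_zero]
  · rw [map_pow, h0, zero_pow (Nat.succ_ne_zero k)]

theorem cong_product {h N K : ℕ} (hN : ∀ b i n, N ≤ n → d (Sum.inl (b, i, n)) = 0)
    (hK : d (Sum.inr ()) < K) :
    Cong d ((∏ q ∈ Finset.univ.filter (fun q : Fin h × Fin h => q.1 < q.2),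
        Psi (Ya q.1) (Xa q.2)) * Phi (unionA h Xa) *
        ∏' k : ℕ, Phi (fun n => z ^ (k + 1) * unionXY h n) * (1 - z ^ (k + 1))⁻¹)
      (truncatedProduct (fun m => (1 - m)⁻¹) h N K) := by
  have hz0 : ∀ k, MvPowerSeries.constantCoeff (z ^ (k + 1)) = 0 := fun k => by
    rw [map_pow, z, MvPowerSeries.constantCoeff_X, zero_pow (Nat.succ_ne_zero k)]
  have hzu : ∀ k n, MvPowerSeries.constantCoeff (z ^ (k + 1) * unionXY h n) = 0 := fun k n => by
    rw [map_mul, hz0, zero_mul]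
  have hbound : ∀ k e, ∃ M, ∀ n, M ≤ n → Cong e (z ^ (k + 1) * unionXY h n) 0 := fun k e => by
    obtain ⟨N', hN'⟩ := exists_bound e
    exact ⟨2 * (h * N'), fun n hn => Cong.mul_zero _ (cong_unionXY hN' hn)⟩
  refine Cong.mul (Cong.mul ?_ ?_) ?_
  · rw [prod_fin_lt h fun i j => Psi (Ya i) (Xa j)]
    refine Cong.prod fun j _ => ?_
    rw [map_concat, psiList_concat]
    refine Cong.prod fun i _ => ?_
    simp only [letters, List.map_map]
    refine cong_Psi (fun n => MvPowerSeries.constantCoeff_X _) (fun e => ?_)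
      fun n hn => ⟨cong_X_zero (hN _ _ _ hn), cong_X_zero (hN _ _ _ hn)⟩
    obtain ⟨N', hN'⟩ := exists_bound e
    exact ⟨N', fun n hn => ⟨cong_X_zero (hN' _ _ _ hn), cong_X_zero (hN' _ _ _ hn)⟩⟩
  · rw [← phiList_perm _ ((unionA_perm h N false (A := Xa) fun _ _ => rfl).trans
      ((concat_perm _ _).map _))]
    refine cong_Phi (fun n => constantCoeff_unionA h n fun _ _ => MvPowerSeries.constantCoeff_X _)
      (fun e => ?_) fun n hn => cong_unionA (fun _ _ hn => cong_X_zero (hN _ _ _ hn)) hn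
    obtain ⟨N', hN'⟩ := exists_bound e
    exact ⟨h * N', fun n hn => cong_unionA (fun _ _ hn => cong_X_zero (hN' _ _ _ hn)) hn⟩
  · have h1 : ∀ (e : Idx →₀ ℕ) (K : ℕ), e (Sum.inr ()) < K → ∀ k ∉ Finset.range K,
        Cong e (Phi (fun n => z ^ (k + 1) * unionXY h n) * (1 - z ^ (k + 1))⁻¹) 1 := by
      intro e K hK k hk
      have hk' : K ≤ k := by simpa using hk
      have hz : Cong e (z ^ (k + 1)) 0 := cong_X_pow_zero (by omega)
      have h2 := (cong_Phi (hzu k) (hbound k) (M := 0) fun n _ => hz.zero_mul _).mul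
        (cong_inv_one (hz0 k) hz)
      simpa [phiList] using h2
    refine (cong_tprod (fun e => ⟨_, h1 e _ (Nat.lt_succ_self _)⟩) (h1 d K hK)).trans
      (Cong.prod fun k _ => Cong.mul ?_ (Cong.refl _))
    have h2 := (unionXY_perm h N).map (z ^ (k + 1) * ·)
    rw [List.map_map, List.map_map] at h2
    have h3 := phiList_perm (fun m : R1 => (1 - m)⁻¹) h2
    refine (cong_Phi (hzu k) (hbound k) (M := 2 * (h * N)) fun n hn =>
      Cong.mul_zero _ (cong_unionXY hN hn)).trans ?_
    exact h3 ▸ Cong.refl _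

theorem cong_sum {h N n : ℕ} (hN : ∀ b i n, N ≤ n → d (Sum.inl (b, i, n)) = 0)
    (hn : d (Sum.inr ()) < 2 * n) :
    Cong d (ssum fun p : (Fin (h + 1) → Ptn) × (Fin h → Ptn) =>
      (MvPowerSeries.X (Sum.inr ()) : EPS Idx) ^ (p.1 (Fin.last h)).size *
        ∏ i : Fin h,
          skewE (fun n => MvPowerSeries.X (Sum.inl (false, (i : ℕ), n))) (p.1 i.castSucc) (p.2 i) *
          skewE (fun n => MvPowerSeries.X (Sum.inl (true, (i : ℕ), n))) (p.1 i.succ) (p.2 i))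
      (truncatedProduct geo h N (2 * n)) := by
  have hz : ∀ m, 2 * n ≤ m → Cong d ((MvPowerSeries.X (Sum.inr ()) : EPS Idx) ^ m) 0 :=
    fun m hm => cong_X_pow_zero (by omega)
  have h1 : ∀ b i lam mu, Cong d
      (skewE (fun n => (MvPowerSeries.X (Sum.inl (b, i, n)) : EPS Idx)) lam mu)
      (stripList ((letters b N i).map MvPowerSeries.X) mu lam) := fun b i lam mu => by
    rw [letters, List.map_map]
    exact cong_skewE (fun n hn => cong_X_zero (hN _ _ _ hn)) lam mu
  refine (Cong.ssum fun p => (Cong.refl _).mul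
    (Cong.prod fun i _ => (h1 _ _ _ _).mul (h1 _ _ _ _))).trans ?_
  rw [finite_summation (MvPowerSeries.X (Sum.inr ()))
    (fun i => (letters false N i).map MvPowerSeries.X)
    (fun i => (letters true N i).map MvPowerSeries.X)]
  simp only [← map_concat, ← map_concatRev]
  refine Cong.mul (Cong.refl _) ?_
  rw [← List.map_append, weightedSum_iterate _ _ n, Finset.prod_mul_distrib]
  simp only [List.map_map]
  refine Cong.mul (Cong.refl _) ((cong_weightedSum _ fun x hx => ?_).trans
    (cong_weightedSum_nil hz))
  obtain ⟨s, -, rfl⟩ := List.mem_map.1 hx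
  exact (hz _ le_rfl).zero_mul _

theorem rel_skewSchur {s : ℕ → Idx} (hs : ∀ e : Idx →₀ ℕ, ∃ N, ∀ n, N ≤ n → e (s n) = 0)
    (lam mu : Ptn) : Rel (skewSchur (fun n => (MvPowerSeries.X (s n) : R1)) lam mu)
      (skewE (fun n => MvPowerSeries.X (s n)) lam mu) := by
  have h1 : ∃ g, Rel g (skewE (fun n => MvPowerSeries.X (s n)) lam mu) := by
    refine exists_rel fun e => ?_
    obtain ⟨N, hN⟩ := hs e
    rw [(cong_skewE (fun n hn => cong_X_zero (hN n hn)) lam mu).coeff_eq]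
    obtain ⟨g, hg⟩ := exists_rel_stripList (l := (List.range N).map fun n =>
      (MvPowerSeries.X (s n) : EPS Idx)) (fun x hx => by
        obtain ⟨n, -, rfl⟩ := List.mem_map.1 hx
        exact ⟨_, rel_X _⟩) mu lam
    obtain ⟨m, -, hm⟩ := rel_iff.1 hg e
    exact ⟨m, hm⟩
  obtain ⟨g, hg⟩ := h1
  have h2 : HasSum (fun c : {c : ℕ → Ptn // IsSchurChain mu lam c} =>
      chainWeight (fun n => (MvPowerSeries.X (s n) : R1)) c.1) g := by
    refine hasSum_of_rel (fun c => ?_) hg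
    obtain ⟨M, hM⟩ := c.2.2.2
    rw [chainWeight, finprod_chain _ hM, finprod_chain _ hM]
    exact Rel.prod fun i _ => (rel_X _).pow _
  rw [skewSchur, h2.tsum_eq]
  exact hg

end Truncation

end CompleteSummation

open CompleteSummation

/-- **Complete summation formula** for skew Schur functions (Theorem 2.2,
equation (2.5)):
`Σ_{λ^0,…,λ^h} Σ_{μ^0,…,μ^{h-1}} z^{|λ^h|} ∏_i s_{λ^i/μ^i}(X^i) s_{λ^{i+1}/μ^i}(Y^i)
  = ∏_{0≤i<j≤h-1} Ψ(Y^i, X^j) · Φ(X) · ∏_{k≥1} Φ(z^k(X+Y))/(1-z^k)`. -/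
theorem complete_summation_formula (h : ℕ) :
    ∑' p : (Fin (h + 1) → Ptn) × (Fin h → Ptn),
      z ^ (p.1 (Fin.last h)).size *
        ∏ i : Fin h,
          skewSchur (Xa i) (p.1 i.castSucc) (p.2 i) * skewSchur (Ya i) (p.1 i.succ) (p.2 i)
    = (∏ q ∈ Finset.univ.filter (fun q : Fin h × Fin h => q.1 < q.2), Psi (Ya q.1) (Xa q.2)) *
        Phi (unionA h Xa) *
        ∏' k : ℕ, Phi (fun n => z ^ (k + 1) * unionXY h n) * (1 - z ^ (k + 1))⁻¹ := by
  refine (hasSum_of_rel (U := fun p => MvPowerSeries.X (Sum.inr ()) ^ (p.1 (Fin.last h)).size *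
      ∏ i : Fin h,
        skewE (fun n => MvPowerSeries.X (Sum.inl (false, (i : ℕ), n))) (p.1 i.castSucc) (p.2 i) *
        skewE (fun n => MvPowerSeries.X (Sum.inl (true, (i : ℕ), n))) (p.1 i.succ) (p.2 i))
    (fun p => ?_) (rel_iff.2 fun d => ?_)).tsum_eq
  · have vanish (b : Bool) (i : ℕ) (e : Idx →₀ ℕ) :
        ∃ N, ∀ n, N ≤ n → e (Sum.inl (b, i, n)) = 0 :=
      let ⟨N, hN⟩ := exists_bound e
      ⟨N, hN b i⟩
    exact ((rel_X _).pow _).mul (Rel.prod fun i _ =>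
      (rel_skewSchur (s := fun n => Sum.inl (false, (i : ℕ), n)) (vanish _ _) _ _).mul
        (rel_skewSchur (s := fun n => Sum.inl (true, (i : ℕ), n)) (vanish _ _) _ _))
  · obtain ⟨N, hN⟩ := exists_bound d
    obtain ⟨m, h1, h2⟩ := rel_iff.1 (rel_truncatedProduct h N (2 * (d (Sum.inr ()) + 1))) d
    exact ⟨m, (cong_product hN (by omega)).coeff_eq.trans h1,
      (cong_sum hN (by omega)).coeff_eq.trans h2⟩
end

section
/- Trace generating function (cylindric form): let δ=(δ_1,...,δ_h) be a profile, u_0,u_1,... formal variables, and U_j = u_0 u_1 ⋯ u_{j−1}. The sum over all skew doubled shifted plane partitions ω=(λ^0,λ^1,...,λ^h) with profile δ satisfying λ^0=λ^h of ∏_{i=0}^h u_i^{|λ^i|} equals ∏_{1≤i<j≤h, δ_i>δ_j} (1 − U_i^{−1}U_j)^{−1} · ∏_{k≥1} Ψ({U_i U_{h+1}^k : δ_i=−1}, {U_j^{−1} : δ_j=1})/(1 − U_{h+1}^k), as an identity of formal power series. -/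
open scoped BigOperators

/-- `δ` is a `±1`-profile on the indices `1, …, h` -/
def IsProfile (h : ℕ) (δ : ℕ → ℤ) : Prop := ∀ i, 1 ≤ i → i ≤ h → δ i = 1 ∨ δ i = -1

/-- A skew doubled shifted plane partition `ω = (λ^0, …, λ^{m-1})` with profile
`(δ_1, …, δ_{m-1})`: if `δ_{i+1} = 1` then `λ^i ≺ λ^{i+1}`, and if
`δ_{i+1} = -1` then `λ^i ≻ λ^{i+1}`. -/
def IsDSPP (m : ℕ) (δ : ℕ → ℤ) (L : Fin m → Ptn) : Prop :=
  ∀ (i : ℕ) (hi : i + 1 < m),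
    if δ (i + 1) = 1 then HStrip (L ⟨i, Nat.lt_of_succ_lt hi⟩) (L ⟨i + 1, hi⟩)
    else HStrip (L ⟨i + 1, hi⟩) (L ⟨i, Nat.lt_of_succ_lt hi⟩)
/-- the ambient ring: formal power series in the variables `u_0, u_1, …` -/
abbrev RU : Type := MvPowerSeries ℕ ℚ

/-- the formal variable `u_i` -/
noncomputable def u (i : ℕ) : RU := MvPowerSeries.X i

/-- `U_j = u_0 u_1 ⋯ u_{j-1}` -/
noncomputable def U (j : ℕ) : RU := ∏ t ∈ Finset.range j, u t

/-- `U_i⁻¹ U_j = u_i u_{i+1} ⋯ u_{j-1}` (for `i ≤ j`) -/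
noncomputable def Urat (i j : ℕ) : RU := ∏ t ∈ Finset.Ico i j, u t

namespace Ptn

theorem ext_part {lam mu : Ptn} (h : ∀ i, lam.part i = mu.part i) : lam = mu := by
  cases lam; cases mu
  congr
  exact Finsupp.ext h

theorem part_anti (lam : Ptn) {i j : ℕ} (h : i ≤ j) : lam.part j ≤ lam.part i :=
  lam.antitone' h

theorem part_eventually_zero (lam : Ptn) : ∃ N, ∀ i, N ≤ i → lam.part i = 0 := by
  refine ⟨lam.toFun.support.sup id + 1, fun i hi => ?_⟩
  by_contra hne
  have hmem : i ∈ lam.toFun.support := Finsupp.mem_support_iff.2 hne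
  have := Finset.le_sup (f := id) hmem
  simp only [id] at this
  omega

theorem size_eq_sum (lam : Ptn) {N : ℕ} (h : lam.part N = 0) :
    lam.size = ∑ i ∈ Finset.range N, lam.part i := by
  refine Finsupp.sum_of_support_subset _ (fun i hi => ?_) _ (by simp)
  rw [Finset.mem_range]
  by_contra hle
  have h0 := lam.part_anti (not_lt.1 hle)
  rw [h] at h0
  exact Finsupp.mem_support_iff.1 hi (Nat.le_zero.1 h0)

/-- The partition with the given parts. -/
noncomputable def ofParts (f : ℕ → ℕ) (hf : ∀ i, f (i + 1) ≤ f i) (N : ℕ) (hN : f N = 0) : Ptn where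
  toFun := Finsupp.ofSupportFinite f <| (Set.finite_Iio N).subset fun i hi => by
    by_contra hle
    have h0 : f i ≤ f N := antitone_nat_of_succ_le hf (not_lt.1 hle)
    rw [hN] at h0
    exact hi (Nat.le_zero.1 h0)
  antitone' := antitone_nat_of_succ_le hf

@[simp] theorem part_ofParts (f : ℕ → ℕ) (hf N hN) (i : ℕ) :
    (ofParts f hf N hN).part i = f i := rfl

end Ptn

theorem HStrip.size_le {mu lam : Ptn} (h : HStrip mu lam) : mu.size ≤ lam.size := by
  obtain ⟨N, hN⟩ := lam.part_eventually_zero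
  have h0 := hN N le_rfl
  rw [lam.size_eq_sum h0, mu.size_eq_sum (Nat.le_zero.1 (h0 ▸ (h N).1))]
  exact Finset.sum_le_sum fun i _ => (h i).1

theorem HStrip.refl (lam : Ptn) : HStrip lam lam :=
  fun i => ⟨le_rfl, lam.part_anti (Nat.le_succ i)⟩

theorem HStrip.eq_of_size_le {mu lam : Ptn} (h : HStrip mu lam) (hs : lam.size ≤ mu.size) :
    mu = lam := by
  obtain ⟨N, hN⟩ := lam.part_eventually_zero
  have hz : ∀ i, N ≤ i → mu.part i = 0 := fun i hi => Nat.le_zero.1 (hN i hi ▸ (h i).1)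
  have hsize := le_antisymm h.size_le hs
  rw [lam.size_eq_sum (hN N le_rfl), mu.size_eq_sum (hz N le_rfl),
    Finset.sum_eq_sum_iff_of_le fun i _ => (h i).1] at hsize
  refine Ptn.ext_part fun i => ?_
  by_cases hi : i < N
  · exact hsize i (Finset.mem_range.2 hi)
  · rw [hN i (not_lt.1 hi), hz i (not_lt.1 hi)]

section LocalMove

variable {lam mu : Ptn}

/-- The local rule turning a partition above `λ` and `μ` into one below both. -/
noncomputable def localDown (lam mu κ : Ptn) (h₁ : HStrip lam κ) (h₂ : HStrip mu κ) : Ptn :=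
  Ptn.ofParts
    (fun i => min (lam.part i) (mu.part i) + max (lam.part (i + 1)) (mu.part (i + 1))
      - κ.part (i + 1))
    (fun i => by
      have := h₁ (i + 1); have := h₂ (i + 1); have := h₁ i; have := h₂ i
      have := h₁ (i + 1 + 1); have := h₂ (i + 1 + 1)
      omega)
    (lam.part_eventually_zero.choose)
    (by
      have := lam.part_eventually_zero.choose_spec _ le_rfl
      have := h₁ (lam.part_eventually_zero.choose + 1)
      have := h₂ (lam.part_eventually_zero.choose + 1)
      omega)

theorem exists_forall_part_eq_zero (lam mu : Ptn) :
    ∃ N, ∀ i, N ≤ i → lam.part i = 0 ∧ mu.part i = 0 := by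
  obtain ⟨N, hN⟩ := lam.part_eventually_zero
  obtain ⟨M, hM⟩ := mu.part_eventually_zero
  exact ⟨max N M, fun i hi => ⟨hN i (by omega), hM i (by omega)⟩⟩

/-- The parts of `localUp`. -/
def localUpPart (lam mu ν : Ptn) (n : ℕ) : ℕ → ℕ
  | 0 => max (lam.part 0) (mu.part 0) + n
  | i + 1 => min (lam.part i) (mu.part i) + max (lam.part (i + 1)) (mu.part (i + 1)) - ν.part i

/-- The local rule turning a partition below `λ` and `μ`, and a natural number, into a partition
above both. -/
noncomputable def localUp (lam mu ν : Ptn) (n : ℕ) (h₁ : HStrip ν lam) (h₂ : HStrip ν mu) : Ptn :=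
  Ptn.ofParts (localUpPart lam mu ν n)
    (fun i => by
      cases i with
      | zero =>
        have := h₁ 0; have := h₂ 0
        simp only [localUpPart]
        omega
      | succ i =>
        have := h₁ (i + 1); have := h₂ (i + 1); have := h₁ i; have := h₂ i
        simp only [localUpPart]
        omega)
    ((exists_forall_part_eq_zero lam mu).choose + 1)
    (by
      have hs := (exists_forall_part_eq_zero lam mu).choose_spec
      have := hs _ le_rfl
      have := hs _ (Nat.le_add_right _ 1)
      simp only [localUpPart]
      omega)

theorem localUp_part_zero {ν : Ptn} (n : ℕ) (h₁ : HStrip ν lam) (h₂ : HStrip ν mu) :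
    (localUp lam mu ν n h₁ h₂).part 0 = max (lam.part 0) (mu.part 0) + n := rfl

theorem localUp_part_succ {ν : Ptn} (n : ℕ) (h₁ : HStrip ν lam) (h₂ : HStrip ν mu) (i : ℕ) :
    (localUp lam mu ν n h₁ h₂).part (i + 1) =
      min (lam.part i) (mu.part i) + max (lam.part (i + 1)) (mu.part (i + 1)) - ν.part i := rfl

/-- The local growth bijection. -/
noncomputable def localEquiv (lam mu : Ptn) :
    {κ : Ptn // HStrip lam κ ∧ HStrip mu κ} ≃ {ν : Ptn // HStrip ν lam ∧ HStrip ν mu} × ℕ where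
  toFun κ := (⟨localDown lam mu κ.1 κ.2.1 κ.2.2, by
      constructor <;> intro i <;> have := κ.2.1 i <;> have := κ.2.2 i <;>
        have := κ.2.1 (i + 1) <;> have := κ.2.2 (i + 1) <;>
        simp only [localDown, Ptn.part_ofParts] <;> omega⟩,
    κ.1.part 0 - max (lam.part 0) (mu.part 0))
  invFun p := ⟨localUp lam mu p.1.1 p.2 p.1.2.1 p.1.2.2, by
      constructor <;> rintro (_ | i) <;> rw [localUp_part_succ] <;>
        [rw [localUp_part_zero]; rw [localUp_part_succ]; rw [localUp_part_zero];
          rw [localUp_part_succ]] <;>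
        [have := p.1.2.1 0; have := p.1.2.1 i; have := p.1.2.1 0; have := p.1.2.1 i] <;>
        [have := p.1.2.2 0; have := p.1.2.2 i; have := p.1.2.2 0; have := p.1.2.2 i] <;>
        [skip; have := p.1.2.1 (i + 1); skip; have := p.1.2.1 (i + 1)] <;>
        [skip; have := p.1.2.2 (i + 1); skip; have := p.1.2.2 (i + 1)] <;>
        omega⟩
  left_inv κ := by
    refine Subtype.ext (Ptn.ext_part fun i => ?_)
    cases i with
    | zero =>
      have := κ.2.1 0; have := κ.2.2 0
      rw [localUp_part_zero]
      simp only
      omega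
    | succ i =>
      have := κ.2.1 i; have := κ.2.2 i; have := κ.2.1 (i + 1); have := κ.2.2 (i + 1)
      rw [localUp_part_succ]
      simp only [localDown, Ptn.part_ofParts]
      omega
  right_inv p := by
    refine Prod.ext (Subtype.ext (Ptn.ext_part fun i => ?_)) ?_
    · have := p.1.2.1 i; have := p.1.2.2 i
      simp only [localDown, Ptn.part_ofParts, localUp_part_succ]
      omega
    · simp only [localUp_part_zero]
      omega

theorem size_localUp {ν : Ptn} (n : ℕ) (h₁ : HStrip ν lam) (h₂ : HStrip ν mu) :
    (localUp lam mu ν n h₁ h₂).size + ν.size = lam.size + mu.size + n := by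
  obtain ⟨N, hN⟩ := exists_forall_part_eq_zero lam mu
  obtain ⟨hl, hm⟩ := hN N le_rfl
  obtain ⟨hl', hm'⟩ := hN (N + 1) (Nat.le_succ N)
  have hsum : ∀ K, (∑ i ∈ Finset.range (K + 1), (localUp lam mu ν n h₁ h₂).part i)
      + ∑ i ∈ Finset.range K, ν.part i
      = ∑ i ∈ Finset.range K, lam.part i + ∑ i ∈ Finset.range K, mu.part i + n
        + max (lam.part K) (mu.part K) := by
    intro K
    induction K with
    | zero => simp [localUp_part_zero, add_comm]
    | succ K ih =>
      simp only [Finset.sum_range_succ _ (K + 1), Finset.sum_range_succ _ K] at ih ⊢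
      have := h₁ K; have := h₂ K
      have hK : (localUp lam mu ν n h₁ h₂).part (K + 1) = min (lam.part K) (mu.part K)
        + max (lam.part (K + 1)) (mu.part (K + 1)) - ν.part K := rfl
      omega
  have hκ : (localUp lam mu ν n h₁ h₂).part (N + 1) = 0 := by
    simp [localUp_part_succ, hl, hl', hm, hm']
  rw [Ptn.size_eq_sum _ hκ, Ptn.size_eq_sum _ hl, Ptn.size_eq_sum _ hm,
    ν.size_eq_sum (Nat.le_zero.1 (hl ▸ (h₁ N).1)), hsum N, hl, hm]
  simp

end LocalMove

open scoped Classical in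
/-- The skew Cauchy identity with one variable on each side, in weighted form. -/
theorem tsum_above_eq_tsum_below (lam mu : Ptn) (F : ℤ → ENNReal) :
    (∑' κ : Ptn, if HStrip lam κ ∧ HStrip mu κ then F κ.size else 0)
      = ∑' ν : Ptn, if HStrip ν lam ∧ HStrip ν mu then
          ∑' n : ℕ, F (lam.size + mu.size + n - ν.size) else 0 := by
  have key (P : Ptn → Prop) [DecidablePred P] (g : Ptn → ENNReal) :
      (∑' κ, if P κ then g κ else 0) = ∑' κ : {κ // P κ}, g κ := by
    refine .trans ?_ (tsum_subtype {κ | P κ} g).symm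
    simp [Set.indicator_apply]
  rw [key, key, ← (localEquiv lam mu).symm.tsum_eq, ENNReal.tsum_prod']
  refine tsum_congr fun ν => tsum_congr fun n => congrArg F ?_
  have := size_localUp n ν.2.1 ν.2.2
  change ((localUp lam mu ν.1 n ν.2.1 ν.2.2).size : ℤ) = _
  omega

section Words

open scoped Classical

variable {G : Type*} [AddCommGroup G]

/-- One step of a walk: up a horizontal strip if `s`, down otherwise. -/
def Step (s : Bool) (lam κ : Ptn) : Prop := if s then HStrip lam κ else HStrip κ lam

/-- The weighted sum, against the test function `f`, over all walks from `λ` to `μ` following the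
word `w`; the letter `(s, b)` contributes `(|κ| - |λ|) • b` to the weight. -/
noncomputable def walkSum : List (Bool × G) → Ptn → Ptn → (G → ENNReal) → ENNReal
  | [], lam, mu, f => if lam = mu then f 0 else 0
  | a :: w, lam, mu, f => ∑' κ : Ptn, if Step a.1 lam κ then
      walkSum w κ mu (fun g => f (g + ((κ.size : ℤ) - lam.size) • a.2)) else 0

/-- The effect on a test function of multiplying by the geometric series with ratio `z`. -/
noncomputable def geo (z : G) (f : G → ENNReal) : G → ENNReal :=
  fun g => ∑' n : ℕ, f (g + n • z)

instance : LeftCommutative (geo : G → (G → ENNReal) → (G → ENNReal)) where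
  left_comm z z' f := by
    funext g
    simp only [geo]
    rw [ENNReal.tsum_comm]
    exact tsum_congr fun m => tsum_congr fun n => by rw [add_right_comm]

/-- The effect on a test function of multiplying by several geometric series. -/
noncomputable def geos (M : Multiset G) (f : G → ENNReal) : G → ENNReal := M.foldr geo f

theorem geos_zero (f : G → ENNReal) : geos 0 f = f := Multiset.foldr_zero ..

theorem geos_cons (z : G) (M : Multiset G) (f : G → ENNReal) :
    geos (z ::ₘ M) f = geo z (geos M f) := Multiset.foldr_cons ..

theorem geos_add (M N : Multiset G) (f : G → ENNReal) : geos (M + N) f = geos M (geos N f) :=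
  Multiset.foldr_add ..

theorem geo_shift (z c : G) (f : G → ENNReal) :
    geo z (fun g => f (g + c)) = fun g => geo z f (g + c) :=
  funext fun g => tsum_congr fun n => by rw [add_right_comm]

theorem geos_shift (M : Multiset G) (c : G) (f : G → ENNReal) :
    geos M (fun g => f (g + c)) = fun g => geos M f (g + c) := by
  induction M using Multiset.induction_on with
  | empty => simp only [geos_zero]
  | cons z M ih => rw [geos_cons, ih, geo_shift, geos_cons]

theorem tsum_ite_comm {α β : Type*} (P : α → Prop) (F : α → β → ENNReal) :
    (∑' a, if P a then ∑' b, F a b else 0) = ∑' b, ∑' a, if P a then F a b else 0 := by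
  rw [ENNReal.tsum_comm]
  refine tsum_congr fun a => ?_
  split_ifs <;> simp

theorem walkSum_tsum {β : Type*} (w : List (Bool × G)) (lam mu : Ptn) (f : β → G → ENNReal) :
    walkSum w lam mu (fun g => ∑' b, f b g) = ∑' b, walkSum w lam mu (f b) := by
  induction w generalizing lam f with
  | nil => simp only [walkSum]; split_ifs <;> simp
  | cons a w ih =>
    simp only [walkSum]
    rw [← tsum_ite_comm]
    exact tsum_congr fun κ => by rw [ih]

theorem walkSum_cons_cons (a b : Bool × G) (w : List (Bool × G)) (lam mu : Ptn)
    (f : G → ENNReal) : walkSum (a :: b :: w) lam mu f =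
      ∑' ρ : Ptn, ∑' κ : Ptn, if Step a.1 lam κ ∧ Step b.1 κ ρ then walkSum w ρ mu
        (fun g => f (g + ((ρ.size : ℤ) - κ.size) • b.2 + ((κ.size : ℤ) - lam.size) • a.2))
        else 0 := by
  simp only [walkSum]
  rw [ENNReal.tsum_comm]
  refine tsum_congr fun κ => ?_
  by_cases h : Step a.1 lam κ <;> simp [h]

/-- The sums over walks along `w` are those along `w'` times geometric series with ratios
in `M`. -/
def Reach (M : Multiset G) (w w' : List (Bool × G)) : Prop :=
  ∀ lam mu f, walkSum w lam mu f = walkSum w' lam mu (geos M f)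

theorem Reach.refl (w : List (Bool × G)) : Reach 0 w w := fun lam mu f => by rw [geos_zero]

theorem Reach.trans {M N : Multiset G} {w₁ w₂ w₃ : List (Bool × G)} (h : Reach M w₁ w₂)
    (h' : Reach N w₂ w₃) : Reach (M + N) w₁ w₃ := fun lam mu f => by
  rw [h, h', add_comm, geos_add]

theorem Reach.cons {M : Multiset G} {w w' : List (Bool × G)} (h : Reach M w w') (a : Bool × G) :
    Reach M (a :: w) (a :: w') := fun lam mu f => by
  simp only [walkSum]
  refine tsum_congr fun κ => ?_
  rw [h, geos_shift]

theorem reach_swap (b b' : G) (w : List (Bool × G)) :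
    Reach {b - b'} ((true, b) :: (false, b') :: w) ((false, b') :: (true, b) :: w) := by
  intro lam mu f
  rw [walkSum_cons_cons, walkSum_cons_cons]
  refine tsum_congr fun ρ => ?_
  simp only [Step, if_true, Bool.false_eq_true, if_false]
  have := tsum_above_eq_tsum_below lam ρ fun k => walkSum w ρ mu
    (fun g => f (g + ((ρ.size : ℤ) - k) • b' + (k - lam.size) • b))
  rw [this]
  refine tsum_congr fun ν => ?_
  split_ifs with h
  · rw [← walkSum_tsum]
    congr 1
    funext g
    rw [← Multiset.cons_zero, geos_cons, geos_zero]
    refine tsum_congr fun n => congrArg f ?_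
    module
  · rfl

theorem reach_up_past (b : G) (A R : List (Bool × G)) (hA : ∀ a ∈ A, a.1 = false) :
    Reach (A.map fun a => b - a.2 : List G) ((true, b) :: (A ++ R)) (A ++ (true, b) :: R) := by
  induction A with
  | nil => exact Reach.refl _
  | cons a A ih =>
    obtain ⟨s, b'⟩ := a
    obtain rfl : s = false := hA _ List.mem_cons_self
    exact (reach_swap b b' (A ++ R)).trans
      ((ih fun a ha => hA a (List.mem_cons_of_mem _ ha)).cons (false, b'))

theorem reach_down_past (b : G) (B R : List (Bool × G)) (hB : ∀ a ∈ B, a.1 = true) :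
    Reach (B.map fun a => a.2 - b : List G) (B ++ (false, b) :: R) ((false, b) :: (B ++ R)) := by
  induction B with
  | nil => exact Reach.refl _
  | cons a B ih =>
    obtain ⟨s, b'⟩ := a
    obtain rfl : s = true := hB _ List.mem_cons_self
    have := ((ih fun a ha => hB a (List.mem_cons_of_mem _ ha)).cons (true, b')).trans
      (reach_swap b' b (B ++ R))
    rw [add_comm] at this
    exact this

/-- The ascending letters of a word. -/
def ups (w : List (Bool × G)) : List (Bool × G) := w.filter fun a => a.1

/-- The descending letters of a word. -/
def downs (w : List (Bool × G)) : List (Bool × G) := w.filter fun a => !a.1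

/-- The differences over all pairs of an ascending letter before a descending one. -/
def upDown : List (Bool × G) → Multiset G
  | [] => 0
  | a :: w => (if a.1 then ↑((downs w).map fun c => a.2 - c.2) else 0) + upDown w

/-- The differences over all pairs of a descending letter before an ascending one. -/
def downUp : List (Bool × G) → Multiset G
  | [] => 0
  | a :: w => (if a.1 then 0 else ↑((ups w).map fun c => c.2 - a.2)) + downUp w

theorem reach_sort (w : List (Bool × G)) : Reach (upDown w) w (downs w ++ ups w) := by
  induction w with
  | nil => exact Reach.refl _
  | cons a w ih =>
    obtain ⟨s, b⟩ := a
    cases s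
    · simpa [upDown, downs, ups] using ih.cons (false, b)
    · have h := (ih.cons (true, b)).trans (reach_up_past b (downs w) (ups w) fun a ha => by
        simpa [downs] using (List.mem_filter.1 ha).2)
      rw [add_comm] at h
      simpa [upDown, downs, ups] using h

theorem reach_unsort (w : List (Bool × G)) : Reach (downUp w) (ups w ++ downs w) w := by
  induction w with
  | nil => exact Reach.refl _
  | cons a w ih =>
    obtain ⟨s, b⟩ := a
    cases s
    · have h := (reach_down_past b (ups w) (downs w) fun a ha => by
        simpa [ups] using (List.mem_filter.1 ha).2).trans (ih.cons (false, b))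
      simpa [downUp, downs, ups] using h
    · simpa [downUp, downs, ups] using ih.cons (true, b)

/-- The weighted sum over closed walks following `w`, where the starting point `λ` contributes
`|λ| • q`. -/
noncomputable def loopSum (q : G) (w : List (Bool × G)) (f : G → ENNReal) : ENNReal :=
  ∑' lam : Ptn, walkSum w lam lam fun g => f (g + lam.size • q)

theorem Reach.loopSum {M : Multiset G} {w w' : List (Bool × G)} (h : Reach M w w') (q : G)
    (f : G → ENNReal) : loopSum q w f = loopSum q w' (geos M f) :=
  tsum_congr fun lam => by rw [h, geos_shift]

theorem walkSum_concat (w : List (Bool × G)) (a : Bool × G) (lam mu : Ptn) (f : G → ENNReal) :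
    walkSum (w ++ [a]) lam mu f = ∑' κ : Ptn, if Step a.1 κ mu then
      walkSum w lam κ (fun g => f (g + ((mu.size : ℤ) - κ.size) • a.2)) else 0 := by
  induction w generalizing lam f with
  | nil =>
    simp only [List.nil_append, walkSum]
    rw [tsum_eq_single mu fun κ hκ => by simp [hκ], tsum_eq_single lam fun κ hκ => by
      simp [hκ.symm]]
    simp
  | cons c w ih =>
    simp only [List.cons_append, walkSum, ih]
    rw [tsum_ite_comm]
    refine tsum_congr fun κ => ?_
    by_cases h : Step a.1 κ mu <;> simp only [h, if_true, if_false]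
    · simp only [add_right_comm]
    · simp

theorem loopSum_cons (q : G) (a : Bool × G) (w : List (Bool × G)) (f : G → ENNReal) :
    loopSum q (a :: w) f = loopSum q (w ++ [(a.1, a.2 - q)]) f := by
  simp only [loopSum, walkSum_concat, walkSum]
  rw [ENNReal.tsum_comm]
  refine tsum_congr fun κ => tsum_congr fun lam => ?_
  split_ifs
  · congr 1
    funext g
    congr 1
    module
  · rfl

theorem loopSum_append (q : G) (A B : List (Bool × G)) (f : G → ENNReal) :
    loopSum q (A ++ B) f = loopSum q (B ++ A.map fun a => (a.1, a.2 - q)) f := by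
  induction A generalizing B with
  | nil => simp
  | cons a A ih => rw [List.cons_append, loopSum_cons, List.append_assoc, ih]; simp

/-- Shift the weights of the descending letters. -/
def lowerBy (c : G) (w : List (Bool × G)) : List (Bool × G) :=
  w.map fun a => (a.1, if a.1 then a.2 else a.2 - c)

theorem loopSum_sweep (q : G) (w : List (Bool × G)) (f : G → ENNReal) :
    loopSum q w f = loopSum q (lowerBy q w) (geos (upDown w + downUp (lowerBy q w)) f) := by
  rw [(reach_sort w).loopSum, loopSum_append, add_comm, geos_add, ← (reach_unsort _).loopSum]
  congr 1
  simp only [ups, downs, lowerBy, List.filter_map]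
  congr 1
  · conv_lhs => rw [← List.map_id (List.filter _ w)]
    refine List.map_congr_left fun a ha => ?_
    have := (List.mem_filter.1 ha).2
    ext <;> simp_all
  · refine List.map_congr_left fun a ha => ?_
    have := (List.mem_filter.1 ha).2
    ext <;> simp_all

theorem lowerBy_lowerBy (c d : G) (w : List (Bool × G)) :
    lowerBy d (lowerBy c w) = lowerBy (c + d) w := by
  simp only [lowerBy, List.map_map]
  refine List.map_congr_left fun a _ => ?_
  rcases a with ⟨_ | _, b⟩ <;> simp [sub_sub]

theorem lowerBy_zero (w : List (Bool × G)) : lowerBy 0 w = w := by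
  simp [lowerBy]

theorem loopSum_sweeps (q : G) (w : List (Bool × G)) (N : ℕ) (f : G → ENNReal) :
    loopSum q w f = loopSum q (lowerBy (N • q) w) (geos (∑ k ∈ Finset.range N,
      (upDown (lowerBy (k • q) w) + downUp (lowerBy ((k + 1) • q) w))) f) := by
  induction N with
  | zero => simp [lowerBy_zero, geos_zero]
  | succ N ih =>
    rw [ih, loopSum_sweep, lowerBy_lowerBy, Finset.sum_range_succ, add_comm (∑ k ∈ _, _),
      geos_add _ (∑ k ∈ _, _), succ_nsmul]

end Words

section Limit

open scoped Classical

variable {G : Type*} [AddCommGroup G]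

theorem geos_eq_zero_of_closed {M : Multiset G} {f : G → ENNReal} {P : G → Prop}
    (hM : ∀ z ∈ M, ∀ g, P g → P (g + z)) (hf : ∀ g, P g → f g = 0) {g : G} (hg : P g) :
    geos M f g = 0 := by
  induction M using Multiset.induction_on generalizing g with
  | empty => rw [geos_zero]; exact hf g hg
  | cons z M ih =>
    rw [geos_cons]
    refine ENNReal.tsum_eq_zero.2 fun n => ih (fun y hy => hM y (Multiset.mem_cons_of_mem hy)) ?_
    induction n with
    | zero => simpa using hg
    | succ n hn =>
      rw [succ_nsmul, ← add_assoc]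
      exact hM z (Multiset.mem_cons_self z M) _ hn

/-- Every ascending letter has height `-1` and every descending one height `-1 - N`. -/
def HeightAt (ht : G →+ ℤ) (N : ℕ) (w : List (Bool × G)) : Prop :=
  ∀ a ∈ w, ht a.2 = if a.1 then -1 else -1 - (N : ℤ)

theorem walkSum_eq_zero (ht : G →+ ℤ) {N : ℕ} {w : List (Bool × G)} (hw : HeightAt ht N w)
    {lam mu : Ptn} {f : G → ENNReal} (hf : ∀ g, 0 ≤ ht g + mu.size - lam.size → f g = 0) :
    walkSum w lam mu f = 0 := by
  induction w generalizing lam f with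
  | nil =>
    simp only [walkSum, ite_eq_right_iff]
    rintro rfl
    exact hf 0 (by simp)
  | cons a w ih =>
    simp only [walkSum]
    refine ENNReal.tsum_eq_zero.2 fun κ => ?_
    split_ifs with hs
    · refine ih (fun c hc => hw c (List.mem_cons_of_mem a hc)) fun g hg => hf _ ?_
      have ha := hw a List.mem_cons_self
      rw [map_add, map_zsmul, ha]
      rcases a with ⟨_ | _, b⟩ <;> simp only [Step, Bool.false_eq_true, if_false, if_true] at hs ⊢
      · have := hs.size_le
        have h₁ : (0 : ℤ) ≤ (lam.size - κ.size : ℤ) * N :=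
          mul_nonneg (by omega) (by omega)
        rw [smul_eq_mul]
        linarith
      · rw [smul_eq_mul]
        linarith
    · rfl

theorem walkSum_eq_of_height (ht : G →+ ℤ) {N : ℕ} {w : List (Bool × G)} (hw : HeightAt ht N w)
    {lam mu : Ptn} {f : G → ENNReal} (hf : ∀ g, N ≤ ht g + mu.size - lam.size → f g = 0)
    (hs : mu.size ≤ lam.size) :
    walkSum w lam mu f = if lam = mu then f 0 else 0 := by
  induction w generalizing lam f with
  | nil => rfl
  | cons a w ih =>
    have hw' : HeightAt ht N w := fun c hc => hw c (List.mem_cons_of_mem a hc)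
    have ha := hw a List.mem_cons_self
    have hself : walkSum w lam mu (fun g => f (g + ((lam.size : ℤ) - lam.size) • a.2))
        = if lam = mu then f 0 else 0 := by
      simp only [sub_self, zero_smul, add_zero]
      exact ih hw' hf hs
    rw [walkSum, tsum_eq_single lam]
    · rw [if_pos (by unfold Step; split_ifs <;> exact HStrip.refl lam), hself]
    intro κ hκ
    split_ifs with h
    · rcases a with ⟨_ | _, b⟩ <;>
        simp only [Step, Bool.false_eq_true, if_false, if_true] at h ha ⊢
      · refine walkSum_eq_zero ht hw' fun g hg => hf _ ?_
        have hlt : κ.size < lam.size := by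
          by_contra hle
          exact hκ (h.eq_of_size_le (not_lt.1 hle))
        rw [map_add, map_zsmul, ha, smul_eq_mul]
        have h₁ : (0 : ℤ) ≤ ((lam.size : ℤ) - κ.size - 1) * N :=
          mul_nonneg (by omega) (by omega)
        linarith
      · rw [ih hw' (fun g hg => hf _ ?_) (hs.trans h.size_le), if_neg]
        · rintro rfl
          exact hκ (h.eq_of_size_le hs).symm
        · rw [map_add, map_zsmul, ha, smul_eq_mul]
          linarith
    · rfl

theorem loopSum_eq_of_height (ht : G →+ ℤ) {N : ℕ} {w : List (Bool × G)} (hw : HeightAt ht N w)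
    {q : G} (hq : 0 ≤ ht q) {f : G → ENNReal} (hf : ∀ g, N ≤ ht g → f g = 0) :
    loopSum q w f = ∑' lam : Ptn, f (lam.size • q) := by
  refine tsum_congr fun lam => ?_
  rw [walkSum_eq_of_height ht hw (fun g hg => hf _ ?_) le_rfl, if_pos rfl, zero_add]
  have : 0 ≤ (lam.size : ℤ) * ht q := mul_nonneg (by omega) hq
  rw [map_add, map_nsmul, nsmul_eq_mul]
  linarith

/-- Partitions with at most `K + 1` parts: split off the columns of full height. -/
noncomputable def columnEquiv (K : ℕ) :
    {lam : Ptn // lam.part (K + 1) = 0} ≃ {lam : Ptn // lam.part K = 0} × ℕ where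
  toFun lam := (⟨Ptn.ofParts (fun i => lam.1.part i - lam.1.part K)
    (fun i => Nat.sub_le_sub_right (lam.1.part_anti (Nat.le_succ i)) _) K (Nat.sub_self _),
    Nat.sub_self _⟩, lam.1.part K)
  invFun p := ⟨Ptn.ofParts (fun i => p.1.1.part i + if i ≤ K then p.2 else 0)
    (fun i => by
      have := p.1.1.part_anti (Nat.le_add_right i 1)
      split_ifs <;> omega) (K + 1) (by
      have := p.1.1.part_anti (Nat.le_add_right K 1)
      have := p.1.2
      simp only [add_le_iff_nonpos_right, nonpos_iff_eq_zero, one_ne_zero, if_false]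
      omega), by
      have := p.1.1.part_anti (Nat.le_add_right K 1)
      have := p.1.2
      simp only [Ptn.part_ofParts, add_le_iff_nonpos_right, nonpos_iff_eq_zero, one_ne_zero,
        if_false]
      omega⟩
  left_inv lam := by
    refine Subtype.ext (Ptn.ext_part fun i => ?_)
    simp only [Ptn.part_ofParts]
    split_ifs with h
    · have := lam.1.part_anti h
      omega
    · have h₁ := lam.1.part_anti (Nat.lt_of_not_le h)
      have := lam.2
      simp only [Nat.succ_eq_add_one] at h₁
      omega
  right_inv p := by
    have hp := p.1.2
    refine Prod.ext (Subtype.ext (Ptn.ext_part fun i => ?_)) ?_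
    · simp only [Ptn.part_ofParts, le_refl, if_true]
      split_ifs with h
      · omega
      · have := p.1.1.part_anti (Nat.le_of_not_le h)
        omega
    · simp only [Ptn.part_ofParts, le_refl, if_true]
      omega

theorem size_columnEquiv_symm (K : ℕ) (p : {lam : Ptn // lam.part K = 0} × ℕ) :
    ((columnEquiv K).symm p).1.size = p.1.1.size + (K + 1) * p.2 := by
  have h0 : p.1.1.part (K + 1) = 0 := by
    have := p.1.1.part_anti (Nat.le_add_right K 1)
    have := p.1.2
    omega
  rw [Ptn.size_eq_sum _ ((columnEquiv K).symm p).2, Ptn.size_eq_sum _ h0]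
  have : ∀ i ∈ Finset.range (K + 1),
      ((columnEquiv K).symm p).1.part i = p.1.1.part i + p.2 := fun i hi => by
    change p.1.1.part i + (if i ≤ K then p.2 else 0) = _
    rw [if_pos (by rw [Finset.mem_range] at hi; omega)]
  rw [Finset.sum_congr rfl this, Finset.sum_add_distrib]
  simp

theorem tsum_ptn_bounded (q : G) (K : ℕ) (f : G → ENNReal) :
    ∑' lam : {lam : Ptn // lam.part K = 0}, f (lam.1.size • q)
      = geos (∑ k ∈ Finset.range K, {(k + 1) • q}) f 0 := by
  induction K generalizing f with
  | zero =>
    have h0 : ∀ lam : Ptn, lam.part 0 = 0 → ∀ i, lam.part i = 0 := fun lam h i =>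
      Nat.le_zero.1 (h ▸ lam.part_anti (Nat.zero_le i))
    let e : Ptn := Ptn.ofParts (fun _ => 0) (fun _ => le_rfl) 0 rfl
    rw [tsum_eq_single (⟨e, rfl⟩ : {lam : Ptn // lam.part 0 = 0}) fun lam hlam => (hlam (Subtype.ext
      (Ptn.ext_part fun i => h0 _ lam.2 i))).elim]
    rw [e.size_eq_sum (N := 0) rfl]
    simp [geos_zero]
  | succ K ih =>
    rw [Finset.sum_range_succ, geos_add, ← ih, ← (columnEquiv K).symm.tsum_eq, ENNReal.tsum_prod']
    refine tsum_congr fun lam => ?_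
    rw [← Multiset.cons_zero, geos_cons, geos_zero]
    refine tsum_congr fun n => ?_
    rw [size_columnEquiv_symm]
    congr 1
    simp only [add_smul, mul_smul]
    module

theorem tsum_ptn_eq (ht : G →+ ℤ) {K : ℕ} {q : G} (hq : 1 ≤ ht q) {f : G → ENNReal}
    (hf : ∀ g, K ≤ ht g → f g = 0) :
    ∑' lam : Ptn, f (lam.size • q) = geos (∑ k ∈ Finset.range K, {(k + 1) • q}) f 0 := by
  rw [← tsum_ptn_bounded]
  refine .trans ?_ (tsum_subtype {lam : Ptn | lam.part K = 0} fun lam => f (lam.size • q)).symm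
  refine tsum_congr fun lam => ?_
  rw [Set.indicator_apply]
  split_ifs with h
  · rfl
  · refine hf _ ?_
    obtain ⟨N, hN⟩ := lam.part_eventually_zero
    have hKN : K < N := by
      by_contra hle
      exact h (hN K (not_lt.1 hle))
    have hsz : K ≤ lam.size := by
      rw [lam.size_eq_sum (hN N le_rfl)]
      calc K = ∑ i ∈ Finset.range K, 1 := by simp
        _ ≤ ∑ i ∈ Finset.range K, lam.part i := Finset.sum_le_sum fun i hi => by
            have := lam.part_anti (Finset.mem_range.1 hi).le
            have : lam.part K ≠ 0 := h
            omega
        _ ≤ _ := Finset.sum_le_sum_of_subset (Finset.range_subset_range.2 hKN.le)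
    rw [map_nsmul, nsmul_eq_mul]
    nlinarith

/-- The sum over closed walks, up to height `N`, is a product of geometric series. -/
theorem loopSum_eq_geos (ht : G →+ ℤ) {w : List (Bool × G)} (hw : HeightAt ht 0 w) {q : G}
    (hq : ht q = 1) {N : ℕ} {f : G → ENNReal} (hf : ∀ g, N ≤ ht g → f g = 0)
    {M : Multiset G} (hM : M = ∑ k ∈ Finset.range N,
      (upDown (lowerBy (k • q) w) + downUp (lowerBy ((k + 1) • q) w)))
    (hpos : ∀ z ∈ M, 0 ≤ ht z) :
    loopSum q w f = geos (∑ k ∈ Finset.range N, {(k + 1) • q} + M) f 0 := by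
  have hfM : ∀ g, N ≤ ht g → geos M f g = 0 := fun g hg =>
    geos_eq_zero_of_closed (P := fun g => N ≤ ht g) (fun z hz g hg => by
      have := hpos z hz
      rw [map_add]
      omega) hf hg
  rw [loopSum_sweeps q w N, ← hM, loopSum_eq_of_height ht (N := N) ?_ (by omega) hfM,
    tsum_ptn_eq ht hq.ge hfM, geos_add]
  intro a ha
  obtain ⟨c, hc, rfl⟩ := List.mem_map.1 ha
  have := hw c hc
  dsimp only
  split_ifs with h
  · simpa [h] using this
  · rw [map_sub, map_nsmul, hq, this]
    simp [h]

theorem walkSum_ofFn {m : ℕ} (ℓ : Fin m → Bool × G) (lam mu : Ptn) (f : G → ENNReal) :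
    walkSum (List.ofFn ℓ) lam mu f = ∑' L : Fin (m + 1) → Ptn,
      if L 0 = lam ∧ L (Fin.last m) = mu ∧ ∀ i, Step (ℓ i).1 (L i.castSucc) (L i.succ) then
        f (∑ i, (((L i.succ).size : ℤ) - (L i.castSucc).size) • (ℓ i).2) else 0 := by
  induction m generalizing lam f with
  | zero =>
    rw [← (Equiv.funUnique (Fin 1) Ptn).symm.tsum_eq, tsum_eq_single lam fun κ hκ => by simp [hκ]]
    simp [walkSum]
  | succ m ih =>
    rw [← (Fin.consEquiv fun _ => Ptn).tsum_eq, ENNReal.tsum_prod']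
    conv_rhs => rw [tsum_eq_single lam fun κ hκ => by simp [hκ]]
    simp only [List.ofFn_succ, walkSum, ih]
    rw [tsum_ite_comm]
    refine tsum_congr fun L => ?_
    rw [tsum_eq_single (L 0) fun κ hκ => by simp [hκ.symm]]
    simp only [Fin.consEquiv_apply, Fin.cons_zero, true_and, ← Fin.succ_last, Fin.cons_succ,
      Fin.forall_fin_succ (n := m), Fin.castSucc_zero, ← Fin.succ_castSucc, Fin.sum_univ_succ]
    by_cases h : Step (ℓ 0).1 lam (L 0) <;> simp [h, add_comm]

theorem loopSum_ofFn (q : G) {m : ℕ} (ℓ : Fin m → Bool × G) (f : G → ENNReal) :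
    loopSum q (List.ofFn ℓ) f = ∑' L : Fin (m + 1) → Ptn,
      if L 0 = L (Fin.last m) ∧ ∀ i, Step (ℓ i).1 (L i.castSucc) (L i.succ) then
        f (∑ i, (((L i.succ).size : ℤ) - (L i.castSucc).size) • (ℓ i).2 + (L 0).size • q)
      else 0 := by
  simp only [loopSum, walkSum_ofFn]
  rw [ENNReal.tsum_comm]
  refine tsum_congr fun L => ?_
  rw [tsum_eq_single (L 0) fun κ hκ => by simp [hκ.symm]]
  simp [eq_comm]

end Limit

section Series

open MvPowerSeries

/-- Exponent vectors as integer-valued functions. -/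
def toInts : (ℕ →₀ ℕ) →+ (ℕ → ℤ) where
  toFun m i := m i
  map_zero' := by ext; simp
  map_add' _ _ := by ext; simp

theorem toInts_apply (m : ℕ →₀ ℕ) (i : ℕ) : toInts m i = m i := rfl

theorem toInts_injective : Function.Injective toInts := fun _ _ h =>
  Finsupp.ext fun i => Int.ofNat_inj.1 (congrFun h i)

/-- The geometric series `1 / (1 - u ^ m)`. -/
noncomputable def geomSeries (m : ℕ →₀ ℕ) : RU := (1 - monomial m (1 : ℚ))⁻¹

theorem one_sub_monomial_mul_geomSeries {m : ℕ →₀ ℕ} (hm : m ≠ 0) :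
    (1 - monomial m (1 : ℚ)) * geomSeries m = 1 := by
  classical
  refine MvPowerSeries.mul_inv_cancel _ ?_
  rw [← coeff_zero_eq_constantCoeff_apply, map_sub, coeff_monomial, if_neg hm.symm]
  simp

open scoped Classical in
/-- The test function detecting the exponent `v`. -/
noncomputable def detect (v g : ℕ → ℤ) : ENNReal := if g = v then 1 else 0

theorem exists_geos_eq_coeff (M : Multiset (ℕ →₀ ℕ)) (hM : ∀ m ∈ M, m ≠ 0) (v : ℕ →₀ ℕ) :
    ∃ c : ℕ, geos (M.map toInts) (detect (toInts v)) 0 = c ∧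
      coeff v (M.map geomSeries).prod = c := by
  classical
  induction M using Multiset.induction_on generalizing v with
  | empty =>
    refine ⟨if v = 0 then 1 else 0, ?_, ?_⟩
    · simp only [Multiset.map_zero, geos_zero, detect, ← map_zero toInts, toInts_injective.eq_iff,
        eq_comm (a := (0 : ℕ →₀ ℕ))]
      split_ifs <;> simp
    · simp [coeff_one]
  | cons m M ih =>
    have hm : m ≠ 0 := hM m (Multiset.mem_cons_self m M)
    induction hd : v.degree using Nat.strong_induction_on generalizing v with
    | _ d ihd =>
      obtain ⟨c, hc, hc'⟩ := ih (fun k hk => hM k (Multiset.mem_cons_of_mem hk)) v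
      have hstep : geos ((m ::ₘ M).map toInts) (detect (toInts v)) 0 =
          c + geos ((m ::ₘ M).map toInts) (detect (toInts v)) (toInts m) := by
        rw [← hc, Multiset.map_cons, geos_cons, geo, tsum_eq_zero_add' ENNReal.summable]
        simp only [zero_smul, add_zero, zero_add, geo, add_smul, one_smul, add_comm]
      have hser : ((m ::ₘ M).map geomSeries).prod = (M.map geomSeries).prod +
          monomial m (1 : ℚ) * ((m ::ₘ M).map geomSeries).prod := by
        rw [Multiset.map_cons, Multiset.prod_cons]
        linear_combination (M.map geomSeries).prod * one_sub_monomial_mul_geomSeries hm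
      by_cases hle : m ≤ v
      · obtain ⟨k, rfl⟩ := exists_add_of_le hle
        have hmd : m.degree ≠ 0 := by simpa [Finsupp.degree_eq_zero_iff] using hm
        obtain ⟨c', h₁, h₂⟩ := ihd k.degree (by rw [← hd, map_add]; omega) k rfl
        refine ⟨c + c', ?_, ?_⟩
        · rw [hstep, Nat.cast_add, ← h₁]
          congr 1
          have := congrFun (geos_shift ((m ::ₘ M).map toInts) (toInts m)
            (detect (toInts (m + k)))) 0
          rw [zero_add] at this
          rw [← this]
          congr 1
          funext g
          simp only [detect, map_add, add_comm (toInts m), add_left_inj]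
        · rw [hser, map_add, hc', coeff_monomial_mul, if_pos hle, one_mul, add_tsub_cancel_left,
            h₂, Nat.cast_add]
      · refine ⟨c, ?_, ?_⟩
        · obtain ⟨i, hi⟩ : ∃ i, v i < m i := by
            by_contra! h
            exact hle h
          rw [hstep, geos_eq_zero_of_closed (P := fun g => (v i : ℤ) < g i), add_zero]
          · intro z hz g hg
            obtain ⟨k, -, rfl⟩ := Multiset.mem_map.1 hz
            have : 0 ≤ toInts k i := Int.natCast_nonneg _
            rw [Pi.add_apply]
            omega
          · intro g hg
            refine if_neg fun h => ?_
            rw [h, toInts_apply] at hg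
            exact lt_irrefl _ hg
          · rw [toInts_apply]
            exact_mod_cast hi
        · rw [hser, map_add, hc', coeff_monomial_mul, if_neg hle, add_zero]

theorem coeff_eq_of_X_pow_dvd {A B : RU} {N : ℕ} (h : (X 0 : RU) ^ N ∣ A - B) {v : ℕ →₀ ℕ}
    (hv : v 0 < N) : coeff v A = coeff v B := by
  have := X_pow_dvd_iff.1 h v hv
  rwa [map_sub, sub_eq_zero] at this

theorem X_pow_dvd_geomSeries_sub_one {m : ℕ →₀ ℕ} {N : ℕ} (h : N ≤ m 0) :
    (X 0 : RU) ^ N ∣ geomSeries m - 1 := by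
  classical
  rcases Nat.eq_zero_or_pos N with rfl | hN
  · simp
  have hm : m ≠ 0 := by
    rintro rfl
    simp only [Finsupp.coe_zero, Pi.zero_apply] at h
    omega
  have : geomSeries m - 1 = monomial m (1 : ℚ) * geomSeries m := by
    linear_combination one_sub_monomial_mul_geomSeries hm
  rw [this]
  refine Dvd.dvd.mul_right (X_pow_dvd_iff.2 fun v hv => ?_) _
  rw [coeff_monomial, if_neg]
  rintro rfl
  omega

theorem dvd_mul_sub_one {R : Type*} [CommRing R] {d a b : R} (ha : d ∣ a - 1) (hb : d ∣ b - 1) :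
    d ∣ a * b - 1 := by
  have : a * b - 1 = (a - 1) * b + (b - 1) := by ring
  rw [this]
  exact dvd_add (ha.mul_right b) hb

theorem dvd_prod_sub_one {R ι : Type*} [CommRing R] {d : R} {s : Finset ι} {f : ι → R}
    (h : ∀ i ∈ s, d ∣ f i - 1) : d ∣ ∏ i ∈ s, f i - 1 :=
  Finset.prod_induction f (fun a => d ∣ a - 1) (fun _ _ => dvd_mul_sub_one) (by simp) h

instance : T2Space RU := inferInstanceAs (T2Space ((ℕ →₀ ℕ) → ℚ))

/-- An infinite product whose factors tend to `1` in the variable `u_0` agrees to each order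
with its partial products. -/
theorem X_pow_dvd_tprod_sub_prod {Q : ℕ → RU} (hQ : ∀ k, (X 0 : RU) ^ (k + 1) ∣ Q k - 1) (N : ℕ) :
    (X 0 : RU) ^ N ∣ ∏' k, Q k - ∏ k ∈ Finset.range N, Q k := by
  have hpart : ∀ (n : ℕ) (s : Finset ℕ), Finset.range n ⊆ s →
      (X 0 : RU) ^ n ∣ ∏ k ∈ s, Q k - ∏ k ∈ Finset.range n, Q k := fun n s hs => by
    rw [← Finset.prod_sdiff hs, ← sub_one_mul]
    refine (dvd_prod_sub_one fun k hk => ?_).mul_right _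
    refine (pow_dvd_pow _ ?_).trans (hQ k)
    simp only [Finset.mem_sdiff, Finset.mem_range] at hk
    omega
  let P : RU := fun v => coeff v (∏ k ∈ Finset.range (v 0 + 1), Q k)
  have hP : HasProd Q P := by
    unfold HasProd
    rw [SummationFilter.unconditional_filter]
    refine tendsto_pi_nhds.2 fun v => ?_
    refine tendsto_const_nhds.congr' ?_
    filter_upwards [Filter.eventually_ge_atTop (Finset.range (v 0 + 1))] with s hs
    exact (coeff_eq_of_X_pow_dvd (hpart (v 0 + 1) s hs) (Nat.lt_succ_self _)).symm
  rw [hP.tprod_eq]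
  refine X_pow_dvd_iff.2 fun v hv => ?_
  rw [map_sub, sub_eq_zero]
  exact (coeff_eq_of_X_pow_dvd (hpart (v 0 + 1) _ (Finset.range_subset_range.2 hv))
    (Nat.lt_succ_self _)).symm

/-- A family of monomials whose exponents hit each value a prescribed number of times is
summable. -/
theorem tsum_monomial_eq {S : Type*} (wt : S → ℕ →₀ ℕ) (R : RU)
    (h : ∀ v, ∃ c : ℕ, (∑' s, detect (toInts v) (toInts (wt s))) = c ∧ coeff v R = c) :
    ∑' s, (monomial (wt s) (1 : ℚ) : RU) = R := by
  classical
  refine HasSum.tsum_eq (Pi.hasSum.2 fun v => ?_)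
  obtain ⟨c, hc, hc'⟩ := h v
  change HasSum (fun s => coeff v (monomial (wt s) (1 : ℚ))) (coeff v R)
  have hcard : ({s | wt s = v}.encard : ENNReal) = c := by
    rw [← hc, ← ENNReal.tsum_set_one,
      tsum_subtype {s | wt s = v} (fun _ => (1 : ENNReal))]
    refine tsum_congr fun s => ?_
    simp [detect, toInts_injective.eq_iff, Set.indicator_apply]
  have hcard' : {s | wt s = v}.encard = c := by exact_mod_cast hcard
  have hfin := Set.finite_of_encard_eq_coe hcard'
  rw [hfin.encard_eq_coe_toFinset_card] at hcard'
  have hcard'' : hfin.toFinset.card = c := by exact_mod_cast hcard'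
  have hsum : coeff v R = ∑ s ∈ hfin.toFinset, coeff v (monomial (wt s) (1 : ℚ)) := by
    rw [hc', ← hcard'', Finset.sum_congr rfl (g := fun _ => (1 : ℚ))]
    · simp
    · intro s hs
      rw [coeff_monomial, if_pos (hfin.mem_toFinset.1 hs).symm]
  rw [hsum]
  refine hasSum_sum_of_ne_finset_zero fun s hs => ?_
  rw [coeff_monomial, if_neg]
  exact fun hv => hs (hfin.mem_toFinset.2 hv.symm)

end Series

section Profile

open MvPowerSeries

theorem coe_map_filter_ofFn {α β : Type*} (p : α → Bool) (g : α → β) {n : ℕ} (ℓ : Fin n → α) :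
    (↑(((List.ofFn ℓ).filter p).map g) : Multiset β) = ∑ j, if p (ℓ j) then {g (ℓ j)} else 0 := by
  induction n with
  | zero => simp
  | succ n ih =>
    rw [List.ofFn_succ, List.filter_cons, Fin.sum_univ_succ, ← ih]
    split_ifs
    · rw [List.map_cons, ← Multiset.cons_coe, Multiset.singleton_add]
    · rw [zero_add]

theorem upDown_ofFn {G : Type*} [AddCommGroup G] {n : ℕ} (ℓ : Fin n → Bool × G) :
    upDown (List.ofFn ℓ) = ∑ i, ∑ j, if i < j ∧ (ℓ i).1 = true ∧ (ℓ j).1 = false then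
      {(ℓ i).2 - (ℓ j).2} else 0 := by
  induction n with
  | zero => rfl
  | succ n ih =>
    rw [List.ofFn_succ, upDown, downs, coe_map_filter_ofFn, Fin.sum_univ_succ, ih]
    simp only [Fin.sum_univ_succ (n := n), Fin.succ_lt_succ_iff, Fin.succ_pos, Fin.not_lt_zero,
      lt_irrefl, false_and, true_and, if_false, zero_add, Bool.not_eq_true']
    congr 1
    by_cases h : (ℓ 0).1 <;> simp [h]

theorem downUp_ofFn {G : Type*} [AddCommGroup G] {n : ℕ} (ℓ : Fin n → Bool × G) :
    downUp (List.ofFn ℓ) = ∑ i, ∑ j, if i < j ∧ (ℓ i).1 = false ∧ (ℓ j).1 = true then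
      {(ℓ j).2 - (ℓ i).2} else 0 := by
  induction n with
  | zero => rfl
  | succ n ih =>
    rw [List.ofFn_succ, downUp, ups, coe_map_filter_ofFn, Fin.sum_univ_succ, ih]
    simp only [Fin.sum_univ_succ (n := n), Fin.succ_lt_succ_iff, Fin.succ_pos, Fin.not_lt_zero,
      lt_irrefl, false_and, true_and, if_false, zero_add]
    congr 1
    by_cases h : (ℓ 0).1 <;> simp [h]

/-- The exponent of `u_i u_{i+1} ⋯ u_{j-1}`. -/
noncomputable def block (i j : ℕ) : ℕ →₀ ℕ := ∑ t ∈ Finset.Ico i j, Finsupp.single t 1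

theorem block_apply (i j t : ℕ) : block i j t = if i ≤ t ∧ t < j then 1 else 0 := by
  classical
  simp [block, Finsupp.finsetSum_apply, Finsupp.single_apply]

theorem prod_monomial {ι : Type*} (s : Finset ι) (m : ι → ℕ →₀ ℕ) :
    ∏ i ∈ s, (monomial (m i) (1 : ℚ) : RU) = monomial (∑ i ∈ s, m i) 1 := by
  classical
  induction s using Finset.induction_on with
  | empty => simp
  | insert a s ha ih =>
    rw [Finset.prod_insert ha, Finset.sum_insert ha, ih, monomial_mul_monomial, one_mul]

theorem Urat_eq_monomial (i j : ℕ) : Urat i j = monomial (block i j) 1 :=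
  prod_monomial (Finset.Ico i j) fun t => Finsupp.single t 1

theorem U_eq_monomial (j : ℕ) : U j = monomial (block 0 j) 1 := by
  rw [← Urat_eq_monomial, Urat, U, Finset.range_eq_Ico]

theorem U_pow_eq_monomial (j k : ℕ) : U j ^ k = monomial (k • block 0 j) 1 := by
  rw [U_eq_monomial, monomial_pow, one_pow]

/-- The letters attached to a profile. -/
noncomputable def profileLetter (δ : ℕ → ℤ) (i : ℕ) : Bool × (ℕ → ℤ) :=
  (decide (δ (i + 1) = 1), -toInts (block 0 (i + 1)))

/-- The exponent for an ascent at `i + 1` and a descent at `j + 1 > i + 1`. -/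
noncomputable def upDownExp (h k i j : ℕ) : ℕ →₀ ℕ := block (i + 1) (j + 1) + k • block 0 (h + 1)

/-- The exponent for a descent at `i + 1` and an ascent at `j + 1`. -/
noncomputable def downUpExp (h k i j : ℕ) : ℕ →₀ ℕ :=
  block 0 (i + 1) + block (j + 1) (h + 1) + k • block 0 (h + 1)

theorem downUpExp_of_lt {h i j : ℕ} (k : ℕ) (hji : j < i) (hi : i < h) :
    downUpExp h k i j = upDownExp h (k + 1) j i := by
  ext t
  simp only [downUpExp, upDownExp, Finsupp.add_apply, Finsupp.smul_apply, block_apply, add_smul,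
    one_smul]
  split_ifs <;> omega

theorem toInts_upDownExp {h i j : ℕ} (k : ℕ) (hij : i < j) :
    -toInts (block 0 (i + 1)) - (-toInts (block 0 (j + 1)) - k • toInts (block 0 (h + 1)))
      = toInts (upDownExp h k i j) := by
  ext t
  simp only [upDownExp, map_add, map_nsmul]
  simp only [Pi.add_apply, Pi.sub_apply, Pi.neg_apply, Pi.smul_apply, toInts_apply, block_apply]
  split_ifs <;> simp <;> omega

theorem toInts_downUpExp {h i j : ℕ} (k : ℕ) (hj : j < h) :
    -toInts (block 0 (j + 1)) - (-toInts (block 0 (i + 1)) - (k + 1) • toInts (block 0 (h + 1)))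
      = toInts (downUpExp h k i j) := by
  ext t
  simp only [downUpExp, map_add, map_nsmul, add_smul, one_smul]
  simp only [Pi.add_apply, Pi.sub_apply, Pi.neg_apply, Pi.smul_apply, toInts_apply, block_apply]
  split_ifs <;> simp <;> omega

/-- The exponents of the factors for an ascent before a descent. -/
noncomputable def upDownExps (h : ℕ) (δ : ℕ → ℤ) (k : ℕ) : Multiset (ℕ →₀ ℕ) :=
  ∑ i : Fin h, ∑ j : Fin h, if i < j ∧ δ (i + 1) = 1 ∧ δ (j + 1) ≠ 1 then
    {upDownExp h k i j} else 0

/-- The exponents of the factors for a descent before an ascent. -/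
noncomputable def downUpExps (h : ℕ) (δ : ℕ → ℤ) (k : ℕ) : Multiset (ℕ →₀ ℕ) :=
  ∑ i : Fin h, ∑ j : Fin h, if i < j ∧ δ (i + 1) ≠ 1 ∧ δ (j + 1) = 1 then
    {downUpExp h k i j} else 0

theorem Multiset.map_finset_sum {ι α β : Type*} (s : Finset ι) (f : ι → Multiset α) (g : α → β) :
    (∑ i ∈ s, f i).map g = ∑ i ∈ s, (f i).map g :=
  map_sum (Multiset.mapAddMonoidHom g) f s

theorem lowerBy_ofFn {G : Type*} [AddCommGroup G] (c : G) {n : ℕ} (ℓ : Fin n → Bool × G) :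
    lowerBy c (List.ofFn ℓ) =
      List.ofFn fun i => ((ℓ i).1, if (ℓ i).1 then (ℓ i).2 else (ℓ i).2 - c) := by
  rw [lowerBy, List.map_ofFn]
  rfl

theorem upDown_lowerBy_profile (h : ℕ) (δ : ℕ → ℤ) (k : ℕ) :
    upDown (lowerBy (k • toInts (block 0 (h + 1)))
      (List.ofFn fun i : Fin h => profileLetter δ i)) = (upDownExps h δ k).map toInts := by
  rw [lowerBy_ofFn, upDown_ofFn, upDownExps, Multiset.map_finset_sum]
  refine Finset.sum_congr rfl fun i _ => ?_
  rw [Multiset.map_finset_sum]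
  refine Finset.sum_congr rfl fun j _ => ?_
  simp only [profileLetter, decide_eq_true_eq, decide_eq_false_iff_not]
  split_ifs <;> first | rfl | tauto | skip
  rw [toInts_upDownExp k (by simp_all), Multiset.map_singleton]

theorem downUp_lowerBy_profile (h : ℕ) (δ : ℕ → ℤ) (k : ℕ) :
    downUp (lowerBy ((k + 1) • toInts (block 0 (h + 1)))
      (List.ofFn fun i : Fin h => profileLetter δ i)) = (downUpExps h δ k).map toInts := by
  rw [lowerBy_ofFn, downUp_ofFn, downUpExps, Multiset.map_finset_sum]
  refine Finset.sum_congr rfl fun i _ => ?_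
  rw [Multiset.map_finset_sum]
  refine Finset.sum_congr rfl fun j _ => ?_
  simp only [profileLetter, decide_eq_true_eq, decide_eq_false_iff_not]
  split_ifs <;> first | rfl | tauto | skip
  rw [toInts_downUpExp k j.2, Multiset.map_singleton]

theorem ne_zero_of_mem_upDownExps {h : ℕ} {δ : ℕ → ℤ} {k : ℕ} {m : ℕ →₀ ℕ}
    (hm : m ∈ upDownExps h δ k) : m ≠ 0 := by
  simp only [upDownExps, Multiset.mem_sum, Finset.mem_univ, true_and] at hm
  obtain ⟨i, j, hm⟩ := hm
  split_ifs at hm with hc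
  · rw [Multiset.mem_singleton.1 hm]
    intro h0
    have := DFunLike.congr_fun h0 ((i : ℕ) + 1)
    have hij : (i : ℕ) < j := hc.1
    simp only [upDownExp, Finsupp.add_apply, block_apply, Finsupp.coe_zero, Pi.zero_apply] at this
    rw [if_pos (by omega)] at this
    omega
  · simp at hm

theorem downUpExp_zero (h k i j : ℕ) : downUpExp h k i j 0 = k + 1 := by
  simp [downUpExp, block_apply, add_comm]

theorem ne_zero_of_mem_downUpExps {h : ℕ} {δ : ℕ → ℤ} {k : ℕ} {m : ℕ →₀ ℕ}
    (hm : m ∈ downUpExps h δ k) : m ≠ 0 := by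
  simp only [downUpExps, Multiset.mem_sum, Finset.mem_univ, true_and] at hm
  obtain ⟨i, j, hm⟩ := hm
  split_ifs at hm with hc
  · rw [Multiset.mem_singleton.1 hm]
    intro h0
    have := DFunLike.congr_fun h0 0
    rw [downUpExp_zero] at this
    simp at this
  · simp at hm

/-- All exponents of the factors of order less than `N`. -/
noncomputable def factorExps (h : ℕ) (δ : ℕ → ℤ) (N : ℕ) : Multiset (ℕ →₀ ℕ) :=
  ∑ k ∈ Finset.range N, {(k + 1) • block 0 (h + 1)}
    + ∑ k ∈ Finset.range N, (upDownExps h δ k + downUpExps h δ k)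

theorem ne_zero_of_mem_factorExps {h : ℕ} {δ : ℕ → ℤ} {N : ℕ} {m : ℕ →₀ ℕ}
    (hm : m ∈ factorExps h δ N) : m ≠ 0 := by
  simp only [factorExps, Multiset.mem_add, Multiset.mem_sum, Multiset.mem_singleton] at hm
  rcases hm with ⟨k, -, rfl⟩ | ⟨k, -, hk | hk⟩
  · intro h0
    have := DFunLike.congr_fun h0 0
    simp [block_apply] at this
  · exact ne_zero_of_mem_upDownExps hk
  · exact ne_zero_of_mem_downUpExps hk

theorem loopSum_profile (h : ℕ) (δ : ℕ → ℤ) {N : ℕ} {v : ℕ →₀ ℕ} (hv : v 0 < N) :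
    loopSum (toInts (block 0 (h + 1))) (List.ofFn fun i : Fin h => profileLetter δ i)
      (detect (toInts v)) = geos ((factorExps h δ N).map toInts) (detect (toInts v)) 0 := by
  have hmap : (∑ k ∈ Finset.range N, (upDownExps h δ k + downUpExps h δ k)).map toInts =
      ∑ k ∈ Finset.range N,
        (upDown (lowerBy (k • toInts (block 0 (h + 1)))
          (List.ofFn fun i : Fin h => profileLetter δ i)) +
        downUp (lowerBy ((k + 1) • toInts (block 0 (h + 1)))
          (List.ofFn fun i : Fin h => profileLetter δ i))) := by
    rw [Multiset.map_finset_sum]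
    exact Finset.sum_congr rfl fun k _ => by
      rw [Multiset.map_add, ← upDown_lowerBy_profile, ← downUp_lowerBy_profile]
  rw [loopSum_eq_geos (Pi.evalAddMonoidHom (fun _ : ℕ => ℤ) 0) ?_ ?_ (N := N) ?_ hmap ?_]
  · simp only [factorExps, Multiset.map_add, Multiset.map_finset_sum, Multiset.map_singleton,
      map_nsmul]
  · intro a ha
    obtain ⟨i, rfl⟩ := (List.mem_ofFn' _ _).1 ha
    simp [profileLetter, toInts_apply, block_apply]
  · simp [toInts_apply, block_apply]
  · intro g hg
    refine if_neg ?_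
    rintro rfl
    simp only [Pi.evalAddMonoidHom_apply, toInts_apply] at hg
    omega
  · intro z hz
    obtain ⟨m, -, rfl⟩ := Multiset.mem_map.1 hz
    exact Int.natCast_nonneg _

/-- The exponent of the monomial attached to a sequence of partitions. -/
noncomputable def sizeExp {h : ℕ} (L : Fin (h + 1) → Ptn) : ℕ →₀ ℕ :=
  ∑ i : Fin (h + 1), Finsupp.single (i : ℕ) (L i).size

theorem sum_by_parts (a : ℕ → ℤ) (h t : ℕ) :
    ∑ i ∈ Finset.range h, (a (i + 1) - a i) * (-(if t < i + 1 then 1 else 0))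
      + a 0 * (if t < h + 1 then 1 else 0) = if t < h + 1 then a t + a 0 - a h else 0 := by
  induction h with
  | zero => by_cases ht : t = 0 <;> simp [ht]
  | succ h ih =>
    rw [Finset.sum_range_succ]
    rcases lt_trichotomy t (h + 1) with hlt | rfl | hgt
    · simp only [hlt, if_true, hlt.trans (Nat.lt_succ_self (h + 1))] at ih ⊢
      linarith
    · simp only [lt_irrefl, if_false, Nat.lt_succ_self, if_true] at ih ⊢
      linarith
    · have h₁ : ¬t < h + 1 := by omega
      have h₂ : ¬t < h + 1 + 1 := by omega
      simp only [h₁, h₂, if_false] at ih ⊢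
      linarith

theorem sizeExp_apply {h : ℕ} (L : Fin (h + 1) → Ptn) (t : ℕ) :
    sizeExp L t = if ht : t < h + 1 then (L ⟨t, ht⟩).size else 0 := by
  classical
  rw [sizeExp, Finsupp.finsetSum_apply]
  simp only [Finsupp.single_apply]
  split_ifs with ht
  · rw [Finset.sum_eq_single ⟨t, ht⟩]
    · simp
    · intro b _ hb
      exact if_neg fun h => hb (Fin.ext h)
    · simp
  · exact Finset.sum_eq_zero fun i _ => if_neg (by omega)

theorem sum_size_sub_smul_eq {h : ℕ} (δ : ℕ → ℤ) {L : Fin (h + 1) → Ptn}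
    (hL : L 0 = L (Fin.last h)) :
    ∑ i : Fin h, (((L i.succ).size : ℤ) - (L i.castSucc).size) • (profileLetter δ i).2
      + (L 0).size • toInts (block 0 (h + 1)) = toInts (sizeExp L) := by
  ext t
  have hsize : ∀ i : Fin (h + 1), ((L i).size : ℤ) = (sizeExp L i : ℕ) := fun i => by
    rw [sizeExp_apply, dif_pos i.2]
  have key := sum_by_parts (fun n => (sizeExp L n : ℤ)) h t
  have h0 : sizeExp L h = sizeExp L 0 := by
    have h₁ := hsize 0
    have h₂ := hsize (Fin.last h)
    rw [hL, h₂] at h₁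
    exact_mod_cast h₁
  rw [h0, add_sub_cancel_right] at key
  rw [Pi.add_apply, Finset.sum_apply, toInts_apply]
  have hlast : (if t < h + 1 then (sizeExp L t : ℤ) else 0) = sizeExp L t := by
    split_ifs with ht
    · rfl
    · rw [sizeExp_apply, dif_neg ht, Nat.cast_zero]
  rw [← hlast, ← key, Finset.sum_range]
  congr 1
  · refine Finset.sum_congr rfl fun i _ => ?_
    simp [profileLetter, toInts_apply, block_apply, hsize]
  · have := hsize 0
    simp [toInts_apply, block_apply, this]

theorem prod_u_pow_size {h : ℕ} (L : Fin (h + 1) → Ptn) :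
    ∏ i : Fin (h + 1), u (i : ℕ) ^ (L i).size = monomial (sizeExp L) (1 : ℚ) := by
  rw [sizeExp, ← prod_monomial]
  refine Finset.prod_congr rfl fun i _ => ?_
  rw [u, X_pow_eq]

theorem isDSPP_iff_step {h : ℕ} {δ : ℕ → ℤ} {L : Fin (h + 1) → Ptn} :
    IsDSPP (h + 1) δ L ↔ ∀ i : Fin h, Step (profileLetter δ i).1 (L i.castSucc) (L i.succ) := by
  constructor
  · intro hL i
    have := hL i (Nat.succ_lt_succ i.2)
    change if δ (i + 1) = 1 then HStrip (L i.castSucc) (L i.succ)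
      else HStrip (L i.succ) (L i.castSucc) at this
    by_cases hi : δ (i + 1) = 1
    · rw [if_pos hi] at this
      simpa [Step, profileLetter, hi] using this
    · rw [if_neg hi] at this
      simpa [Step, profileLetter, hi] using this
  · intro hL i hi
    have := hL ⟨i, Nat.lt_of_succ_lt_succ hi⟩
    split_ifs with hi'
    · simpa [Step, profileLetter, hi'] using this
    · simpa [Step, profileLetter, hi'] using this

theorem tsum_detect_sizeExp (h : ℕ) (δ : ℕ → ℤ) (v : ℕ →₀ ℕ) :
    ∑' ω : {L : Fin (h + 1) → Ptn // IsDSPP (h + 1) δ L ∧ L 0 = L (Fin.last h)},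
      detect (toInts v) (toInts (sizeExp ω.1)) =
    loopSum (toInts (block 0 (h + 1))) (List.ofFn fun i : Fin h => profileLetter δ i)
      (detect (toInts v)) := by
  classical
  rw [loopSum_ofFn]
  refine (tsum_subtype {L | IsDSPP (h + 1) δ L ∧ L 0 = L (Fin.last h)}
    fun L => detect (toInts v) (toInts (sizeExp L))).trans ?_
  refine tsum_congr fun L => ?_
  have hiff : L ∈ {L | IsDSPP (h + 1) δ L ∧ L 0 = L (Fin.last h)} ↔ L 0 = L (Fin.last h) ∧
      ∀ i : Fin h, Step (profileLetter δ i).1 (L i.castSucc) (L i.succ) :=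
    and_comm.trans (and_congr_right fun _ => isDSPP_iff_step)
  split_ifs with hL
  · rw [Set.indicator_of_mem (hiff.2 hL), sum_size_sub_smul_eq δ hL.1]
  · exact Set.indicator_of_notMem (mt hiff.1 hL) _

end Profile

section Product

open MvPowerSeries

theorem prod_map_sum_ite {ι κ α R : Type*} [Fintype ι] [Fintype κ] [CommMonoid R]
    (p : ι → κ → Prop) [∀ i j, Decidable (p i j)] (m : ι → κ → α) (g : α → R) :
    (Multiset.map g (∑ i, ∑ j, if p i j then {m i j} else 0)).prod =
      ∏ i, ∏ j, if p i j then g (m i j) else 1 := by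
  simp only [Multiset.map_finset_sum, Multiset.prod_sum]
  refine Finset.prod_congr rfl fun i _ => Finset.prod_congr rfl fun j _ => ?_
  split_ifs <;> simp

variable {h : ℕ} {δ : ℕ → ℤ}

theorem IsProfile.eq_neg_one_iff (hδ : IsProfile h δ) (i : Fin h) :
    δ (i + 1) = -1 ↔ δ (i + 1) ≠ 1 := by
  have := hδ (i + 1) (by omega) i.2
  omega

theorem prod_filter_descents (hδ : IsProfile h δ) :
    ∏ q ∈ Finset.univ.filter
        (fun q : Fin h × Fin h => q.1 < q.2 ∧ δ ((q.1 : ℕ) + 1) > δ ((q.2 : ℕ) + 1)),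
      (1 - Urat ((q.1 : ℕ) + 1) ((q.2 : ℕ) + 1))⁻¹ =
    ((upDownExps h δ 0).map geomSeries).prod := by
  rw [upDownExps, prod_map_sum_ite, Finset.prod_filter, Fintype.prod_prod_type]
  refine Finset.prod_congr rfl fun i _ => Finset.prod_congr rfl fun j _ => ?_
  have hi := hδ (i + 1) (by omega) i.2
  have hj := hδ (j + 1) (by omega) j.2
  refine if_congr (and_congr_right fun _ => by dsimp only; omega) ?_ rfl
  rw [Urat_eq_monomial, geomSeries, upDownExp, zero_smul, add_zero]

theorem Psi_eq_prod (hδ : IsProfile h δ) (k : ℕ) :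
    Psi (fun n => if n < h ∧ δ (n + 1) = -1 then U (n + 1) else 0)
      (fun n => if n < h ∧ δ (n + 1) = 1 then Urat (n + 1) (h + 1) * U (h + 1) ^ k else 0) =
    ((downUpExps h δ k).map geomSeries).prod * ((upDownExps h δ (k + 1)).map geomSeries).prod := by
  rw [Psi, tprod_eq_prod (s := Finset.range h ×ˢ Finset.range h), Finset.prod_product,
    Finset.prod_range, upDownExps, downUpExps, prod_map_sum_ite, prod_map_sum_ite,
    Finset.prod_comm (f := fun i j : Fin h => if i < j ∧ δ (i + 1) = 1 ∧ δ (j + 1) ≠ 1 then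
      geomSeries (upDownExp h (k + 1) i j) else 1), ← Finset.prod_mul_distrib]
  · refine Finset.prod_congr rfl fun i _ => ?_
    rw [Finset.prod_range, ← Finset.prod_mul_distrib]
    refine Finset.prod_congr rfl fun j _ => ?_
    have hi := hδ.eq_neg_one_iff i
    dsimp only
    by_cases hc : δ (i + 1) ≠ 1 ∧ δ (j + 1) = 1
    · have hfac : (1 - U ((i : ℕ) + 1) * (Urat (j + 1) (h + 1) * U (h + 1) ^ k))⁻¹ =
          geomSeries (downUpExp h k i j) := by
        rw [U_pow_eq_monomial, U_eq_monomial, Urat_eq_monomial, monomial_mul_monomial,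
          monomial_mul_monomial, one_mul, one_mul, ← add_assoc, geomSeries, downUpExp]
      rw [if_pos ⟨i.2, hi.2 hc.1⟩, if_pos ⟨j.2, hc.2⟩, hfac]
      rcases lt_trichotomy i j with hij | rfl | hij
      · rw [if_pos ⟨hij, hc⟩, if_neg fun h' => hij.not_gt h'.1, mul_one]
      · exact absurd hc.2 hc.1
      · rw [if_neg fun h' => hij.not_gt h'.1, if_pos ⟨hij, hc.symm⟩, one_mul,
          downUpExp_of_lt k hij i.2]
    · rw [if_neg (fun h' : i < j ∧ _ => hc h'.2), if_neg (fun h' : j < i ∧ _ => hc h'.2.symm),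
        one_mul]
      have hzero : (if (i : ℕ) < h ∧ δ (i + 1) = -1 then U (i + 1) else 0) *
          (if (j : ℕ) < h ∧ δ (j + 1) = 1 then Urat (j + 1) (h + 1) * U (h + 1) ^ k else 0)
          = 0 := by
        split_ifs with h₁ h₂
        · exact absurd ⟨hi.1 h₁.2, h₂.2⟩ hc
        all_goals simp
      rw [hzero, sub_zero, inv_one]
  · rintro ⟨i, j⟩ hij
    have hij' : ¬(i < h ∧ j < h) := by simpa using hij
    have hzero : (if i < h ∧ δ (i + 1) = -1 then U (i + 1) else 0) *
        (if j < h ∧ δ (j + 1) = 1 then Urat (j + 1) (h + 1) * U (h + 1) ^ k else 0) = 0 := by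
      split_ifs with h₁ h₂
      · exact absurd ⟨h₁.1, h₂.1⟩ hij'
      all_goals simp
    simp only [hzero, sub_zero, inv_one]

theorem X_pow_dvd_prod_map_geomSeries_sub_one {M : Multiset (ℕ →₀ ℕ)} {N : ℕ}
    (hM : ∀ m ∈ M, N ≤ m 0) : (X 0 : RU) ^ N ∣ (M.map geomSeries).prod - 1 := by
  induction M using Multiset.induction_on with
  | empty => simp
  | cons m M ih =>
    rw [Multiset.map_cons, Multiset.prod_cons]
    exact dvd_mul_sub_one (X_pow_dvd_geomSeries_sub_one (hM m (Multiset.mem_cons_self m M)))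
      (ih fun k hk => hM k (Multiset.mem_cons_of_mem hk))

theorem le_apply_zero_of_mem_upDownExps {k : ℕ} {m : ℕ →₀ ℕ} (hm : m ∈ upDownExps h δ k) :
    k ≤ m 0 := by
  simp only [upDownExps, Multiset.mem_sum, Finset.mem_univ, true_and] at hm
  obtain ⟨i, j, hm⟩ := hm
  split_ifs at hm
  · rw [Multiset.mem_singleton.1 hm]
    simp [upDownExp, block_apply]
  · simp at hm

theorem apply_zero_of_mem_downUpExps {k : ℕ} {m : ℕ →₀ ℕ} (hm : m ∈ downUpExps h δ k) :
    m 0 = k + 1 := by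
  simp only [downUpExps, Multiset.mem_sum, Finset.mem_univ, true_and] at hm
  obtain ⟨i, j, hm⟩ := hm
  split_ifs at hm
  · rw [Multiset.mem_singleton.1 hm, downUpExp_zero]
  · simp at hm

theorem inv_one_sub_U_pow (k : ℕ) :
    (1 - U (h + 1) ^ (k + 1))⁻¹ = geomSeries ((k + 1) • block 0 (h + 1)) := by
  rw [U_pow_eq_monomial, geomSeries]

theorem prod_map_factorExps (N : ℕ) :
    ((upDownExps h δ 0).map geomSeries).prod * ∏ k ∈ Finset.range N,
      (((downUpExps h δ k).map geomSeries).prod * ((upDownExps h δ (k + 1)).map geomSeries).prod *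
        geomSeries ((k + 1) • block 0 (h + 1))) =
    ((factorExps h δ N).map geomSeries).prod * ((upDownExps h δ N).map geomSeries).prod := by
  induction N with
  | zero => simp [factorExps]
  | succ N ih =>
    rw [Finset.prod_range_succ, ← mul_assoc, ih]
    simp only [factorExps, Finset.sum_range_succ, Multiset.map_add, Multiset.prod_add,
      Multiset.map_singleton, Multiset.prod_singleton]
    ring

theorem coeff_trace_product (hδ : IsProfile h δ) (v : ℕ →₀ ℕ) :
    coeff v ((∏ q ∈ Finset.univ.filter
          (fun q : Fin h × Fin h => q.1 < q.2 ∧ δ ((q.1 : ℕ) + 1) > δ ((q.2 : ℕ) + 1)),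
          (1 - Urat ((q.1 : ℕ) + 1) ((q.2 : ℕ) + 1))⁻¹) *
        ∏' k : ℕ,
          Psi (fun n => if n < h ∧ δ (n + 1) = -1 then U (n + 1) else 0)
              (fun n => if n < h ∧ δ (n + 1) = 1 then Urat (n + 1) (h + 1) * U (h + 1) ^ k
                else 0) *
            (1 - U (h + 1) ^ (k + 1))⁻¹) =
      coeff v ((factorExps h δ (v 0 + 1)).map geomSeries).prod := by
  simp only [prod_filter_descents hδ, Psi_eq_prod hδ, inv_one_sub_U_pow]
  set Q : ℕ → RU := fun k => ((downUpExps h δ k).map geomSeries).prod *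
    ((upDownExps h δ (k + 1)).map geomSeries).prod * geomSeries ((k + 1) • block 0 (h + 1)) with hQ
  have hdvd : ∀ k, (X 0 : RU) ^ (k + 1) ∣ Q k - 1 := fun k => by
    refine dvd_mul_sub_one (dvd_mul_sub_one ?_ ?_) ?_
    · exact X_pow_dvd_prod_map_geomSeries_sub_one fun m hm =>
        (apply_zero_of_mem_downUpExps hm).ge
    · exact X_pow_dvd_prod_map_geomSeries_sub_one fun m hm => le_apply_zero_of_mem_upDownExps hm
    · exact X_pow_dvd_geomSeries_sub_one (by simp [block_apply])
  rw [coeff_eq_of_X_pow_dvd (N := v 0 + 1) (by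
      rw [← mul_sub]
      exact (X_pow_dvd_tprod_sub_prod hdvd (v 0 + 1)).mul_left _) (Nat.lt_succ_self _),
    hQ, prod_map_factorExps]
  refine coeff_eq_of_X_pow_dvd (N := v 0 + 1) ?_ (Nat.lt_succ_self _)
  rw [← mul_sub_one]
  exact (X_pow_dvd_prod_map_geomSeries_sub_one fun m hm =>
    le_apply_zero_of_mem_upDownExps hm).mul_left _

end Product

/-- **Trace generating function, cylindric form** (Theorem 3.2, equation (3.3)):
for a profile `δ = (δ_1, …, δ_h)`,
`Σ_{ω ∈ DSPP_δ, λ^0 = λ^h} ∏_{i=0}^h u_i^{|λ^i|}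
  = ∏_{1≤i<j≤h, δ_i>δ_j} (1 - U_i⁻¹ U_j)⁻¹
      · ∏_{k≥1} Ψ({U_i U_{h+1}^k : δ_i = -1}, {U_j⁻¹ : δ_j = 1})/(1 - U_{h+1}^k)`.
Since `Ψ(X, Y) = ∏_{i,j} (1 - x_i y_j)⁻¹` only involves the pairwise products
`x_i y_j`, the factor `Ψ({U_i U_{h+1}^k}, {U_j⁻¹})` is written (with exactly the
same pairwise products `U_i U_{h+1}^k U_j⁻¹`) as `Ψ({U_i}, {U_{h+1}^k U_j⁻¹})`,
where the Laurent monomial `U_{h+1}^k U_j⁻¹ = u_j ⋯ u_h · U_{h+1}^{k-1}` (for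
`k ≥ 1`) is the genuine power series `Urat j (h+1) * U (h+1)^(k-1)`. -/
theorem trace_generating_function_cylindric (h : ℕ) (hh : 1 ≤ h) (δ : ℕ → ℤ)
    (hδ : IsProfile h δ) :
    ∑' ω : {L : Fin (h + 1) → Ptn // IsDSPP (h + 1) δ L ∧ L 0 = L (Fin.last h)},
      ∏ i : Fin (h + 1), u (i : ℕ) ^ (ω.1 i).size
    = (∏ q ∈ Finset.univ.filter
          (fun q : Fin h × Fin h => q.1 < q.2 ∧ δ ((q.1 : ℕ) + 1) > δ ((q.2 : ℕ) + 1)),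
          (1 - Urat ((q.1 : ℕ) + 1) ((q.2 : ℕ) + 1))⁻¹) *
        ∏' k : ℕ,
          Psi (fun n => if n < h ∧ δ (n + 1) = -1 then U (n + 1) else 0)
              (fun n => if n < h ∧ δ (n + 1) = 1 then Urat (n + 1) (h + 1) * U (h + 1) ^ k
                else 0) *
            (1 - U (h + 1) ^ (k + 1))⁻¹ := by
  simp only [prod_u_pow_size]
  refine tsum_monomial_eq _ _ fun v => ?_
  obtain ⟨c, hc, hc'⟩ := exists_geos_eq_coeff (factorExps h δ (v 0 + 1))
    (fun m hm => ne_zero_of_mem_factorExps hm) v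
  exact ⟨c, by rw [tsum_detect_sizeExp, loopSum_profile h δ (Nat.lt_succ_self (v 0)), hc],
    by rw [coeff_trace_product hδ, hc']⟩
end
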